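/- arXiv:1805.03997 — 5 statements merged into one kernel-verified Lean document; each statement's English description precedes it below -/
import Mathlib

section
/- If f is analytic on the unit disc with f(0)=0, f'(0)=1, f(z)≠0 for z≠0, and f belongs to S(α,β) (i.e., α < Re(z f'(z)/f(z)) < β for all z in the unit disc, where α < 1 < β), then log(f(z)/z) is subordinate to the function P̂_{α,β}(z) = ∫₀^z (P_{α,β}(t) - 1)/t dt, where P_{α,β}(z) = 1 + ((β-α)/π) i log((1 - e^{2πi(1-α)/(β-α)} z)/(1-z)). -/
open Complex Metric

/-- The vertical strip mapping `P_{α,β}`. -/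
noncomputable def P (α β : ℝ) (z : ℂ) : ℂ :=
  1 + (((β : ℂ) - α) / Real.pi) * Complex.I *
    Complex.log ((1 - Complex.exp (2 * Real.pi * Complex.I *
      (1 - (α : ℂ)) / ((β : ℂ) - α)) * z) / (1 - z))

/-- `P̂_{α,β}(z) = ∫₀^z (P_{α,β}(t) - 1)/t dt`, parametrized along the segment. -/
noncomputable def Phat (α β : ℝ) (z : ℂ) : ℂ :=
  ∫ t in (0 : ℝ)..1, (P α β ((t : ℂ) * z) - 1) / ((t : ℂ) * z) * z

/-- Subordination: `g ≺ h` on the unit disc. -/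
def Subord (g h : ℂ → ℂ) : Prop :=
  ∃ ω : ℂ → ℂ, DifferentiableOn ℂ ω (ball 0 1) ∧ ω 0 = 0 ∧
    (∀ z ∈ ball (0 : ℂ) 1, ω z ∈ ball (0 : ℂ) 1) ∧
    ∀ z ∈ ball (0 : ℂ) 1, g z = h (ω z)

section

open Set Filter Topology

/-- If `F'` has positive real part on a convex set, then so do the slopes of `F`. -/
lemma re_slope_pos {s : Set ℂ} (hs : Convex ℝ s) {F F' : ℂ → ℂ}
    (hF : ∀ z ∈ s, HasDerivAt F (F' z) z) (hpos : ∀ z ∈ s, 0 < (F' z).re)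
    {a b : ℂ} (ha : a ∈ s) (hb : b ∈ s) (hab : b ≠ a) :
    0 < ((F b - F a) / (b - a)).re := by
  have hba : b - a ≠ 0 := sub_ne_zero.2 hab
  have hmem : ∀ t ∈ Icc (0 : ℝ) 1, a + t * (b - a) ∈ s := fun t ht => by
    simpa using hs.add_smul_sub_mem ha hb ht
  have hd : ∀ t ∈ Icc (0 : ℝ) 1, HasDerivAt
      (fun t : ℝ => (F (a + t * (b - a)) / (b - a)).re) (F' (a + t * (b - a))).re t := by
    intro t ht
    have h1 : HasDerivAt (fun t : ℂ => a + t * (b - a)) (b - a) (t : ℂ) := by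
      simpa using ((hasDerivAt_id (t : ℂ)).mul_const (b - a)).const_add a
    have h2 := ((hF _ (hmem t ht)).comp (t : ℂ) h1).div_const (b - a)
    rw [mul_div_cancel_right₀ _ hba] at h2
    exact h2.real_of_complex
  obtain ⟨c, hc, h⟩ := exists_hasDerivAt_eq_slope _ _ zero_lt_one
    (fun t ht => (hd t ht).continuousAt.continuousWithinAt)
    (fun t ht => hd t (Ioo_subset_Icc_self ht))
  have := hpos _ (hmem c (Ioo_subset_Icc_self hc))
  rw [h] at this
  simpa [sub_div] using this

/-- **Jack's lemma**. -/
lemma exists_jack_point {ω : ℂ → ℂ} {r : ℝ} (hr : 0 < r)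
    (hω : ∀ z ∈ closedBall (0 : ℂ) r, DifferentiableAt ℂ ω z) (h0 : ω 0 = 0) :
    ∃ z₀ ∈ closedBall (0 : ℂ) r, (∀ z ∈ closedBall (0 : ℂ) r, ‖ω z‖ ≤ ‖ω z₀‖) ∧
      ∃ m : ℝ, 1 ≤ m ∧ z₀ * deriv ω z₀ = m * ω z₀ := by
  obtain ⟨z₀, hz₀, hmax⟩ := (isCompact_closedBall (0 : ℂ) r).exists_isMaxOn
    ⟨0, mem_closedBall_self hr.le⟩
    (f := fun z => ‖ω z‖) (fun z hz => (hω z hz).continuousAt.norm.continuousWithinAt)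
  replace hmax : ∀ z ∈ closedBall (0 : ℂ) r, ‖ω z‖ ≤ ‖ω z₀‖ := fun z hz => hmax hz
  rcases eq_or_ne (ω z₀) 0 with hM | hM
  · refine ⟨0, mem_closedBall_self hr.le, fun z hz => ?_, 1, le_rfl, by simp [h0]⟩
    simpa [hM, h0] using hmax z hz
  have hMpos : 0 < ‖ω z₀‖ := norm_pos_iff.2 hM
  have hschwarz : ∀ z ∈ ball (0 : ℂ) r, ‖ω z‖ ≤ ‖ω z₀‖ / r * ‖z‖ := fun z hz => by
    simpa [h0] using Complex.dist_le_div_mul_dist_of_mapsTo_ball (f := ω) (c := 0)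
      (R₂ := ‖ω z₀‖)
      (fun z hz => (hω z (ball_subset_closedBall hz)).differentiableWithinAt)
      (fun z hz => by simpa [h0] using hmax z (ball_subset_closedBall hz)) hz
  have hzr : ‖z₀‖ = r := by
    refine le_antisymm (by simpa using hz₀) (not_lt.1 fun hlt => ?_)
    have := hschwarz z₀ (by simpa using hlt)
    rw [div_mul_eq_mul_div, le_div_iff₀ hr] at this
    exact absurd (le_of_mul_le_mul_left this hMpos) (not_le.2 hlt)
  refine ⟨z₀, hz₀, hmax, ?_⟩
  set D := z₀ * deriv ω z₀ / ω z₀ with hD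
  have hdz := (hω z₀ hz₀).hasDerivAt
  have him : D.im = 0 := by
    have h1 : HasDerivAt (fun s : ℂ => z₀ * exp (s * I)) (z₀ * I) ((0 : ℝ) : ℂ) := by
      simpa using (((hasDerivAt_id ((0 : ℝ) : ℂ)).mul_const I).cexp).const_mul z₀
    have h2 : HasDerivAt (fun s : ℂ => ω (z₀ * exp (s * I)) / ω z₀) (D * I) ((0 : ℝ) : ℂ) := by
      have := (HasDerivAt.comp ((0 : ℝ) : ℂ) (h₂ := ω) (h₂' := deriv ω z₀) (by simpa using hdz)
        h1).div_const (ω z₀)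
      refine this.congr_deriv ?_
      rw [hD]; ring
    have h3 := h2.real_of_complex
    have h4 : IsLocalMax (fun s : ℝ => (ω (z₀ * exp (s * I)) / ω z₀).re) 0 := by
      refine Eventually.of_forall fun s => ?_
      have : (ω (z₀ * exp ((s : ℂ) * I)) / ω z₀).re ≤ 1 := by
        refine (re_le_norm _).trans ?_
        rw [norm_div, div_le_one hMpos]
        exact hmax _ (by simp [Complex.norm_exp_ofReal_mul_I, hzr])
      simpa [hM] using this
    simpa using h4.hasDerivAt_eq_zero h3
  have hre : 1 ≤ D.re := by
    have h1 : HasDerivAt (fun t : ℂ => t * z₀) z₀ ((1 : ℝ) : ℂ) := by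
      simpa using (hasDerivAt_id ((1 : ℝ) : ℂ)).mul_const z₀
    have h2 : HasDerivAt (fun t : ℂ => ω (t * z₀) / ω z₀) D ((1 : ℝ) : ℂ) := by
      have := (HasDerivAt.comp ((1 : ℝ) : ℂ) (h₂ := ω) (h₂' := deriv ω z₀) (by simpa using hdz)
        h1).div_const (ω z₀)
      refine this.congr_deriv ?_
      rw [hD]; ring
    have h3 := h2.real_of_complex.hasDerivWithinAt (s := Iio 1)
    rw [hasDerivWithinAt_iff_tendsto_slope' (by simp)] at h3
    refine ge_of_tendsto h3 ?_
    filter_upwards [Ioo_mem_nhdsLT (zero_lt_one (α := ℝ))] with t ht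
    have h5 : (ω (t * z₀) / ω z₀).re ≤ t := by
      refine (re_le_norm _).trans ?_
      rw [norm_div, div_le_iff₀ hMpos]
      refine (hschwarz _ ?_).trans_eq ?_
      · simp only [mem_ball_zero_iff, norm_mul, norm_real, Real.norm_eq_abs, abs_of_pos ht.1, hzr]
        nlinarith [ht.2]
      · simp only [norm_mul, norm_real, Real.norm_eq_abs, abs_of_pos ht.1, hzr]
        field_simp
    rw [slope_def_field, le_div_iff_of_neg (by linarith [ht.2])]
    simp only [ofReal_one, one_mul, div_self hM, one_re]
    linarith
  refine ⟨D.re, hre, ?_⟩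
  have : (D.re : ℂ) = D := Complex.ext (by simp) (by simp [him])
  rw [this, hD, div_mul_cancel₀ _ hM]

/-- `y ↦ (exp y - 1) / (exp y - exp (θ I))` maps the strip `θ / 2 - π < Im y < θ / 2` into the unit
disc. -/
lemma exp_sub_one_norm_lt {θ : ℝ} (h0 : 0 < θ) (h1 : θ < 2 * Real.pi) {y : ℂ}
    (hy1 : θ / 2 - Real.pi < y.im) (hy2 : y.im < θ / 2) :
    ‖exp y - 1‖ < ‖exp y - exp (θ * I)‖ := by
  rw [← sq_lt_sq₀ (norm_nonneg _) (norm_nonneg _), ← normSq_eq_norm_sq, ← normSq_eq_norm_sq]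
  have hs1 : 0 < Real.sin (θ / 2) := Real.sin_pos_of_pos_of_lt_pi (by linarith) (by linarith)
  have hs2 : 0 < Real.sin (θ / 2 - y.im) :=
    Real.sin_pos_of_pos_of_lt_pi (by linarith) (by linarith)
  have key := mul_pos (mul_pos (Real.exp_pos y.re) hs1) hs2
  have e1 : Real.cos θ = 1 - 2 * Real.sin (θ / 2) ^ 2 := by
    rw [← Real.cos_sq_add_sin_sq (θ / 2), show θ = 2 * (θ / 2) by ring, Real.cos_two_mul]
    ring_nf
    nlinarith [Real.cos_sq_add_sin_sq (θ * (1 / 2))]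
  have e2 : Real.sin θ = 2 * Real.sin (θ / 2) * Real.cos (θ / 2) := by
    rw [← Real.sin_two_mul]; ring_nf
  rw [Real.sin_sub] at key
  have e3 := Real.cos_sq_add_sin_sq (θ / 2)
  simp only [normSq_apply, sub_re, sub_im, exp_re, exp_im, one_re, one_im, mul_re, mul_im,
    ofReal_re, ofReal_im, I_re, I_im, mul_zero, sub_zero, add_zero, mul_one,
    Real.exp_zero, one_mul, e1, e2]
  set a := Real.sin (θ / 2)
  set b := Real.cos (θ / 2)
  have hb : b ^ 2 = 1 - a ^ 2 := by linarith
  have : (2 * a * b) ^ 2 = 4 * a ^ 2 * (1 - a ^ 2) := by rw [← hb]; ring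
  nlinarith

lemma exp_ofReal_mul_I_ne_one {θ : ℝ} (h0 : 0 < θ) (h1 : θ < 2 * Real.pi) :
    exp (θ * I) ≠ 1 := fun h => by
  have := exp_sub_one_norm_lt h0 h1 (y := 0) (by simp; linarith) (by simp; linarith)
  simp [h] at this

/-- A branch of `log ((1 - c z) / (1 - z))` on the unit disc, for `‖c‖ = 1`. -/
noncomputable def stripLog (c z : ℂ) : ℂ := log (1 - c * z) - log (1 - z)

lemma one_sub_mul_re_pos {c z : ℂ} (hc : ‖c‖ = 1) (hz : z ∈ ball (0 : ℂ) 1) :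
    0 < (1 - c * z).re := by
  have h := re_le_norm (c * z)
  rw [norm_mul, hc, one_mul] at h
  have : ‖z‖ < 1 := by simpa using hz
  simp only [sub_re, one_re]
  linarith

lemma one_sub_re_pos {z : ℂ} (hz : z ∈ ball (0 : ℂ) 1) : 0 < (1 - z).re := by
  simpa using one_sub_mul_re_pos (c := 1) (by simp) hz

lemma log_div_of_re_pos {a b : ℂ} (ha : 0 < a.re) (hb : 0 < b.re) :
    log (a / b) = log a - log b := by
  have ha0 : a ≠ 0 := fun h => by simp [h] at ha
  have hb0 : b ≠ 0 := fun h => by simp [h] at hb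
  have h1 := abs_lt.1 (abs_arg_lt_pi_div_two_iff.2 (Or.inl ha))
  have h2 := abs_lt.1 (abs_arg_lt_pi_div_two_iff.2 (Or.inl hb))
  have h : exp (log a - log b) = a / b := by rw [exp_sub, exp_log ha0, exp_log hb0]
  rw [← h, log_exp] <;> simp only [sub_im, log_im] <;> linarith

lemma differentiableOn_stripLog {c : ℂ} (hc : ‖c‖ = 1) :
    DifferentiableOn ℂ (stripLog c) (ball 0 1) := by
  intro z hz
  have h1 : 1 - c * z ∈ slitPlane := Or.inl (one_sub_mul_re_pos hc hz)
  have h2 : 1 - z ∈ slitPlane := Or.inl (one_sub_re_pos hz)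
  have h3 : DifferentiableAt ℂ (fun w => 1 - c * w) z := by fun_prop
  have h4 : DifferentiableAt ℂ (fun w : ℂ => 1 - w) z := by fun_prop
  exact ((h3.clog h1).sub (h4.clog h2)).differentiableWithinAt

lemma exp_stripLog {c z : ℂ} (hc : ‖c‖ = 1) (hz : z ∈ ball (0 : ℂ) 1) :
    exp (stripLog c z) = (1 - c * z) / (1 - z) := by
  have h1 := one_sub_mul_re_pos hc hz
  have h2 := one_sub_re_pos hz
  rw [stripLog, exp_sub, exp_log (fun h => by simp [h] at h1), exp_log (fun h => by simp [h] at h2)]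

lemma exp_stripLog_left_inverse {c z : ℂ} (hc : ‖c‖ = 1) (hc1 : c ≠ 1)
    (hz : z ∈ ball (0 : ℂ) 1) :
    (exp (stripLog c z) - 1) / (exp (stripLog c z) - c) = z := by
  have h2 : 1 - z ≠ 0 := fun h => by have := one_sub_re_pos hz; simp [h] at this
  have h3 : 1 - c ≠ 0 := sub_ne_zero.2 hc1.symm
  rw [exp_stripLog hc hz]
  have e1 : (1 - c * z) / (1 - z) - 1 = z * (1 - c) / (1 - z) := by field_simp; ring
  have e2 : (1 - c * z) / (1 - z) - c = (1 - c) / (1 - z) := by field_simp; ring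
  rw [e1, e2]
  field_simp

lemma re_stripLog_div_pos {c z : ℂ} (hc : ‖c‖ = 1) (hc1 : c ≠ 1)
    (hz : z ∈ ball (0 : ℂ) 1) (hz0 : z ≠ 0) : 0 < (stripLog c z / z / (1 - c)).re := by
  have h3 : 1 - c ≠ 0 := sub_ne_zero.2 hc1.symm
  have hne : 1 - c * z ≠ 1 - z := fun h => by
    have : z * (1 - c) = 0 := by linear_combination h
    simp [hz0, h3] at this
  have := re_slope_pos (s := {w : ℂ | 0 < w.re}) (convex_halfSpace_re_gt 0)
    (F := log) (F' := fun w => w⁻¹) (fun w hw => hasDerivAt_log (Or.inl hw))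
    (fun w hw => by
      have hw' : 0 < w.re := hw
      rw [inv_re]
      exact div_pos hw' (normSq_pos.2 fun h => by simp [h] at hw'))
    (a := 1 - z) (b := 1 - c * z) (one_sub_re_pos hz) (one_sub_mul_re_pos hc hz) hne
  rw [show 1 - c * z - (1 - z) = z * (1 - c) by ring, ← div_div] at this
  exact this

/-- An injective holomorphic map with nonvanishing derivative has a holomorphic inverse. -/
lemma exists_holomorphic_inverse {U : Set ℂ} (hU : IsOpen U) {F F' : ℂ → ℂ}
    (hF : ∀ z ∈ U, HasDerivAt F (F' z) z) (hF' : ∀ z ∈ U, F' z ≠ 0) (hinj : InjOn F U) :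
    IsOpen (F '' U) ∧ ∃ k : ℂ → ℂ, DifferentiableOn ℂ k (F '' U) ∧ ∀ z ∈ U, k (F z) = z := by
  have hd : DifferentiableOn ℂ F U := fun z hz => (hF z hz).differentiableAt.differentiableWithinAt
  have hstrict : ∀ z ∈ U, HasStrictDerivAt F (F' z) z := fun z hz => by
    have := (hd.analyticAt (hU.mem_nhds hz)).hasStrictDerivAt
    rwa [(hF z hz).deriv] at this
  have hk : ∀ z ∈ U, Function.invFunOn F U (F z) = z := hinj.leftInvOn_invFunOn
  refine ⟨?_, Function.invFunOn F U, ?_, hk⟩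
  · rw [isOpen_iff_mem_nhds]
    rintro _ ⟨z, hz, rfl⟩
    rw [← (hstrict z hz).map_nhds_eq (hF' z hz)]
    exact image_mem_map (hU.mem_nhds hz)
  · rintro _ ⟨z, hz, rfl⟩
    refine DifferentiableAt.differentiableWithinAt ?_
    refine ((hstrict z hz).to_local_left_inverse (hF' z hz) ?_).hasDerivAt.differentiableAt
    filter_upwards [hU.mem_nhds hz] with w hw using hk w hw

/-- Suffridge's subordination theorem for the strip map: if `Q` satisfies `z Q' = κ stripLog c`
and `z g'` takes values in the strip which is the image of `κ stripLog c`, then `g ≺ Q`. -/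
lemma subord_of_mem_strip {θ : ℝ} (hθ0 : 0 < θ) (hθ1 : θ < 2 * Real.pi) {κ : ℂ} (hκ : κ ≠ 0)
    {Q Q' g : ℂ → ℂ} (hQ : ∀ z ∈ ball (0 : ℂ) 1, HasDerivAt Q (Q' z) z) (hQ0 : Q 0 = 0)
    (hQ' : ∀ z ∈ ball (0 : ℂ) 1, z * Q' z = κ * stripLog (exp (θ * I)) z)
    (hQ'0 : Q' 0 ≠ 0) (hinj : InjOn Q (ball 0 1))
    (hg : DifferentiableOn ℂ g (ball 0 1)) (hg0 : g 0 = 0)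
    (hstrip : ∀ z ∈ ball (0 : ℂ) 1, θ / 2 - Real.pi < (z * deriv g z / κ).im ∧
      (z * deriv g z / κ).im < θ / 2) :
    Subord g Q := by
  have hc : ‖exp (θ * I)‖ = 1 := norm_exp_ofReal_mul_I θ
  have hc1 : exp (θ * I) ≠ 1 := exp_ofReal_mul_I_ne_one hθ0 hθ1
  set c := exp (θ * I)
  have hQne : ∀ z ∈ ball (0 : ℂ) 1, Q' z ≠ 0 := by
    intro z hz h
    rcases eq_or_ne z 0 with rfl | hz0
    · exact hQ'0 h
    · have h1 := hQ' z hz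
      have h2 := re_stripLog_div_pos hc hc1 hz hz0
      rw [h, mul_zero, eq_comm, mul_eq_zero] at h1
      simp [h1.resolve_left hκ] at h2
  obtain ⟨hV, k, hk, hkQ⟩ := exists_holomorphic_inverse isOpen_ball hQ hQne hinj
  set V := Q '' ball 0 1
  have h00 : (0 : ℂ) ∈ ball (0 : ℂ) 1 := mem_ball_self one_pos
  have hk0 : k 0 = 0 := by simpa [hQ0] using hkQ 0 h00
  have hQk : ∀ y ∈ V, Q (k y) = y := by
    rintro _ ⟨z, hz, rfl⟩
    rw [hkQ z hz]
  have hkV : ∀ y ∈ V, k y ∈ ball (0 : ℂ) 1 := by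
    rintro _ ⟨z, hz, rfl⟩
    rwa [hkQ z hz]
  have hgd : ∀ z ∈ ball (0 : ℂ) 1, DifferentiableAt ℂ g z := fun z hz =>
    hg.differentiableAt (isOpen_ball.mem_nhds hz)
  have hkd : ∀ y ∈ V, DifferentiableAt ℂ k y := fun y hy => hk.differentiableAt (hV.mem_nhds hy)
  have hscale : ∀ s ∈ Icc (0 : ℝ) 1, ∀ z ∈ ball (0 : ℂ) 1,
      ‖(exp (s * (z * deriv g z / κ)) - 1) / (exp (s * (z * deriv g z / κ)) - c)‖ ≤ ‖z‖ := by
    intro s hs z hz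
    have hlt : ∀ w ∈ ball (0 : ℂ) 1, ‖exp (s * (w * deriv g w / κ)) - 1‖ <
        ‖exp (s * (w * deriv g w / κ)) - c‖ := fun w hw => by
      obtain ⟨h1, h2⟩ := (convex_Ioo (θ / 2 - Real.pi) (θ / 2)).smul_mem_of_zero_mem
        ⟨by linarith, by linarith⟩ (hstrip w hw) hs
      exact exp_sub_one_norm_lt hθ0 hθ1 (by rwa [im_ofReal_mul]) (by rwa [im_ofReal_mul])
    refine norm_le_norm_of_mapsTo_ball (R := 1)
      (f := fun z => (exp (s * (z * deriv g z / κ)) - 1) / (exp (s * (z * deriv g z / κ)) - c))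
      ?_ ?_ (by simp) (by simpa using hz)
    · have hd : DifferentiableOn ℂ (fun z => exp (s * (z * deriv g z / κ))) (ball 0 1) :=
        (((differentiableOn_id.mul (hg.deriv isOpen_ball)).div_const κ).const_mul _).cexp
      refine (hd.sub_const 1).div (hd.sub_const c) fun w hw h => ?_
      have := hlt w hw
      rw [h, norm_zero] at this
      exact absurd this (not_lt.2 (norm_nonneg _))
    · intro w hw
      have := hlt w hw
      rw [mem_closedBall_zero_iff, norm_div, div_le_one ((norm_nonneg _).trans_lt this)]
      exact this.le
  have hstep : ∀ r : ℝ, 0 < r → r < 1 → (∀ z ∈ closedBall (0 : ℂ) r, g z ∈ V) →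
      ∀ z ∈ closedBall (0 : ℂ) r, ‖k (g z)‖ ≤ r := by
    intro r hr hr1 hgV z hz
    have hsub : closedBall (0 : ℂ) r ⊆ ball 0 1 := closedBall_subset_ball hr1
    obtain ⟨z₀, hz₀, hmax, m, hm, hjack⟩ := exists_jack_point (ω := fun z => k (g z)) hr
      (fun z hz => (hkd _ (hgV z hz)).comp z (hgd z (hsub hz)))
      (by rw [hg0, hk0])
    refine (hmax z hz).trans ?_
    have hz₀1 := hsub hz₀
    have hω₀ := hkV _ (hgV z₀ hz₀)
    have hωd : DifferentiableAt ℂ (fun z => k (g z)) z₀ :=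
      (hkd _ (hgV z₀ hz₀)).comp z₀ (hgd z₀ hz₀1)
    have hderiv : deriv g z₀ = Q' (k (g z₀)) * deriv (fun z => k (g z)) z₀ := by
      have h1 : HasDerivAt (fun z => Q (k (g z)))
          (Q' (k (g z₀)) * deriv (fun z => k (g z)) z₀) z₀ :=
        (hQ _ hω₀).comp z₀ hωd.hasDerivAt
      rw [← h1.deriv]
      refine EventuallyEq.deriv_eq ?_
      filter_upwards [(hgd z₀ hz₀1).continuousAt.preimage_mem_nhds (hV.mem_nhds (hgV z₀ hz₀))]
        with w hw using (hQk _ hw).symm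
    have hm0 : (m : ℂ) ≠ 0 := by exact_mod_cast (by linarith : m ≠ 0)
    have hlog : ((m⁻¹ : ℝ) : ℂ) * (z₀ * deriv g z₀ / κ) = stripLog c (k (g z₀)) := by
      have : z₀ * deriv g z₀ = m * (κ * stripLog c (k (g z₀))) := by
        rw [← hQ' _ hω₀, hderiv]
        linear_combination Q' (k (g z₀)) * hjack
      rw [this, ofReal_inv]
      field_simp
    have := hscale m⁻¹ ⟨by positivity, inv_le_one_of_one_le₀ hm⟩ z₀ hz₀1
    rw [hlog, exp_stripLog_left_inverse hc hc1 hω₀] at this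
    exact this.trans (by simpa using hz₀)
  have hall : ∀ z ∈ ball (0 : ℂ) 1, g z ∈ V := by
    by_contra! ⟨z₁, hz₁, hz₁V⟩
    have hz₁' : ‖z₁‖ < 1 := by simpa using hz₁
    have hsub : closedBall (0 : ℂ) ‖z₁‖ ⊆ ball 0 1 := closedBall_subset_ball hz₁'
    have hB : IsCompact (closedBall (0 : ℂ) ‖z₁‖ ∩ g ⁻¹' Vᶜ) :=
      (isCompact_closedBall _ _).of_isClosed_subset
        ((hg.continuousOn.mono hsub).preimage_isClosed_of_isClosed isClosed_closedBall
          hV.isClosed_compl) inter_subset_left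
    obtain ⟨z₂, ⟨hz₂, hz₂V⟩, hmin⟩ := hB.exists_isMinOn ⟨z₁, by simp, hz₁V⟩
      continuous_norm.continuousOn
    have hz₂1 : ‖z₂‖ < 1 := by simpa using hsub hz₂
    have hlt : ∀ z : ℂ, ‖z‖ < ‖z₂‖ → g z ∈ V := fun z hz => by
      by_contra h
      have hz' : ‖z‖ ≤ ‖z₁‖ := hz.le.trans (by simpa using hz₂)
      exact absurd (hmin ⟨by simpa using hz', h⟩) (not_le.2 hz)
    have hz₂0 : z₂ ≠ 0 := by
      rintro rfl
      exact hz₂V ⟨0, h00, by rw [hQ0, hg0]⟩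
    have hpos : 0 < ‖z₂‖ := norm_pos_iff.2 hz₂0
    have himg : MapsTo g (ball 0 ‖z₂‖) (Q '' closedBall 0 ‖z₂‖) := by
      intro z hz
      have hz' : ‖z‖ < ‖z₂‖ := by simpa using hz
      obtain ⟨r, hr1, hr2⟩ := exists_between hz'
      have hr0 : 0 < r := (norm_nonneg z).trans_lt hr1
      refine ⟨k (g z), ?_, hQk _ (hlt z hz')⟩
      have := hstep r hr0 (hr2.trans hz₂1)
        (fun w hw => hlt w ((mem_closedBall_zero_iff.1 hw).trans_lt hr2)) z (by simpa using hr1.le)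
      simpa using this.trans hr2.le
    have hsub₂ : closedBall (0 : ℂ) ‖z₂‖ ⊆ ball 0 1 := closedBall_subset_ball hz₂1
    have hclosed : IsClosed (Q '' closedBall 0 ‖z₂‖) :=
      ((isCompact_closedBall _ _).image_of_continuousOn fun z hz =>
        (hQ z (hsub₂ hz)).continuousAt.continuousWithinAt).isClosed
    have hmem : z₂ ∈ closure (ball (0 : ℂ) ‖z₂‖) := by
      rw [closure_ball _ hpos.ne']; simp
    exact hz₂V (image_mono hsub₂ <| hclosed.closure_subset <|
      ((hgd z₂ (hsub hz₂)).continuousAt.continuousWithinAt.mem_closure hmem himg))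
  refine ⟨fun z => k (g z), hk.comp hg hall, ?_, fun z hz => hkV _ (hall z hz),
    fun z hz => (hQk _ (hall z hz)).symm⟩
  simp only [hg0, hk0]

/-- `P_{α,β}` in terms of `stripLog`. -/
lemma P_eq_stripLog {α β : ℝ} {z : ℂ} (hz : z ∈ ball (0 : ℂ) 1) :
    P α β z = 1 + ((β - α) / Real.pi : ℝ) * I *
      stripLog (exp ((2 * Real.pi * (1 - α) / (β - α) : ℝ) * I)) z := by
  have e : 2 * Real.pi * I * (1 - (α : ℂ)) / ((β : ℂ) - α) =
      ((2 * Real.pi * (1 - α) / (β - α) : ℝ) : ℂ) * I := by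
    push_cast; ring
  rw [P, e, log_div_of_re_pos (one_sub_mul_re_pos (norm_exp_ofReal_mul_I _) hz)
    (one_sub_re_pos hz), stripLog]
  push_cast
  rfl

/-- The differentiated form of `exp g = f / z`. -/
lemma mul_deriv_eq_of_exp_eq_div {f g : ℂ → ℂ} (hf : DifferentiableOn ℂ f (ball 0 1))
    (hg : DifferentiableOn ℂ g (ball 0 1))
    (hgf : ∀ z ∈ ball (0 : ℂ) 1, z ≠ 0 → exp (g z) = f z / z)
    {z : ℂ} (hz : z ∈ ball (0 : ℂ) 1) (hz0 : z ≠ 0) :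
    z * deriv g z = z * deriv f z / f z - 1 := by
  have hgz := (hg.differentiableAt (isOpen_ball.mem_nhds hz)).hasDerivAt
  have hfz := (hf.differentiableAt (isOpen_ball.mem_nhds hz)).hasDerivAt
  have hE : (fun w => w * exp (g w)) =ᶠ[𝓝 z] f := by
    filter_upwards [isOpen_ball.mem_nhds hz, isOpen_ne.mem_nhds hz0] with w hw hw0
    rw [hgf w hw hw0, mul_div_cancel₀ _ hw0]
  have h := (((hasDerivAt_id z).mul hgz.cexp).congr_of_eventuallyEq hE.symm).unique hfz
  simp only [id, one_mul] at h
  rw [← h, ← hE.eq_of_nhds]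
  have := exp_ne_zero (g z)
  field_simp
  ring

/-- The primitive of `κ stripLog c z / z` on the unit disc exists and is injective. -/
lemma exists_primitive_stripLog_div {c κ : ℂ} (hc : ‖c‖ = 1) (hc1 : c ≠ 1) (hκ : κ ≠ 0) :
    ∃ Q Q' : ℂ → ℂ, (∀ z ∈ ball (0 : ℂ) 1, HasDerivAt Q (Q' z) z) ∧ Q 0 = 0 ∧
      (∀ z, z * Q' z = κ * stripLog c z) ∧ Q' 0 ≠ 0 ∧ InjOn Q (ball 0 1) ∧
      ContinuousOn Q' (ball 0 1) := by
  have hc1' : 1 - c ≠ 0 := sub_ne_zero.2 hc1.symm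
  set h : ℂ → ℂ := fun z => κ * stripLog c z with hh
  have hh0 : h 0 = 0 := by simp [hh, stripLog]
  have hd : DifferentiableOn ℂ (dslope h 0) (ball 0 1) :=
    (differentiableOn_dslope (ball_mem_nhds 0 one_pos)).2
      ((differentiableOn_stripLog hc).const_mul κ)
  have hmul : ∀ z, z * dslope h 0 z = h z := fun z => by
    simpa [hh0] using sub_smul_dslope h 0 z
  have hD0 : dslope h 0 0 = κ * (1 - c) := by
    rw [dslope_same]
    have h1 : HasDerivAt (fun w : ℂ => log (1 - c * w)) (-c) 0 := by
      simpa using (((hasDerivAt_id (0 : ℂ)).const_mul c).const_sub 1).clog (by simp)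
    have h2 : HasDerivAt (fun w : ℂ => log (1 - w)) (-1) 0 := by
      simpa using ((hasDerivAt_id (0 : ℂ)).const_sub 1).clog (by simp)
    have h3 : HasDerivAt h (κ * (-c - -1)) 0 := (h1.sub h2).const_mul κ
    rw [h3.deriv]
    ring
  have hD0' : dslope h 0 0 ≠ 0 := hD0 ▸ mul_ne_zero hκ hc1'
  obtain ⟨G, hG⟩ := hd.isExactOn_ball
  refine ⟨fun z => G z - G 0, dslope h 0, fun z hz => (hG z hz).sub_const _, sub_self _, hmul,
    hD0', fun a ha b hb hab => ?_, hd.continuousOn⟩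
  by_contra hne
  have := re_slope_pos (convex_ball (0 : ℂ) 1) (fun z hz => (hG z hz).div_const (dslope h 0 0))
    (fun z hz => ?_) ha hb (Ne.symm hne)
  · simp [sub_left_inj.1 hab] at this
  · rcases eq_or_ne z 0 with rfl | hz0
    · rw [div_self hD0', one_re]; exact one_pos
    · have := re_stripLog_div_pos hc hc1 hz hz0
      convert this using 2
      rw [hD0, eq_div_of_mul_eq hz0 ((mul_comm _ _).trans (hmul z)), hh]
      field_simp

/-- `P̂_{α,β}` is the primitive, vanishing at `0`, of `(P_{α,β}(z) - 1) / z`. -/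
lemma Phat_eq_of_hasDerivAt {α β : ℝ} {Q Q' : ℂ → ℂ}
    (hQ : ∀ z ∈ ball (0 : ℂ) 1, HasDerivAt Q (Q' z) z) (hQ0 : Q 0 = 0)
    (hQ' : ∀ z ∈ ball (0 : ℂ) 1, z * Q' z = P α β z - 1)
    (hcont : ContinuousOn Q' (ball 0 1)) {z : ℂ} (hz : z ∈ ball (0 : ℂ) 1) :
    Phat α β z = Q z := by
  have hmem : ∀ t ∈ Icc (0 : ℝ) 1, (t : ℂ) * z ∈ ball (0 : ℂ) 1 := fun t ht => by
    simpa using (convex_ball (0 : ℂ) 1).smul_mem_of_zero_mem (mem_ball_self one_pos) hz ht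
  have hFTC : ∫ t in (0 : ℝ)..1, Q' (t * z) * z = Q z := by
    rw [intervalIntegral.integral_eq_sub_of_hasDerivAt (f := fun t : ℝ => Q (t * z))]
    · simp [hQ0]
    · intro t ht
      rw [uIcc_of_le zero_le_one] at ht
      have h1 : HasDerivAt (fun t : ℂ => t * z) z (t : ℂ) := by
        simpa using (hasDerivAt_id (t : ℂ)).mul_const z
      exact ((hQ _ (hmem t ht)).comp (t : ℂ) h1).comp_ofReal
    · refine ContinuousOn.intervalIntegrable ?_
      rw [uIcc_of_le zero_le_one]
      exact (hcont.comp (by fun_prop) hmem).mul continuousOn_const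
  rw [← hFTC, Phat]
  refine intervalIntegral.integral_congr_ae (Eventually.of_forall fun t ht => ?_)
  rw [uIoc_of_le zero_le_one] at ht
  rcases eq_or_ne z 0 with rfl | hz0
  · simp
  · have ht0 : (t : ℂ) ≠ 0 := by exact_mod_cast ht.1.ne'
    rw [← hQ' _ (hmem t (Ioc_subset_Icc_self ht)), mul_div_cancel_left₀ _ (mul_ne_zero ht0 hz0)]

end

/-- If `f ∈ S(α,β)`, then (any analytic branch of) `log(f(z)/z)` is subordinate to
`P̂_{α,β}(z) = ∫₀^z (P_{α,β}(t) - 1)/t dt`. -/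
theorem log_f_div_z_subordinate_Phat (α β : ℝ) (hα : α < 1) (hβ : 1 < β)
    (f : ℂ → ℂ) (hf : DifferentiableOn ℂ f (ball 0 1))
    (hf0 : f 0 = 0) (hf1 : deriv f 0 = 1)
    (hfz : ∀ z ∈ ball (0 : ℂ) 1, z ≠ 0 → f z ≠ 0)
    (hS : ∀ z ∈ ball (0 : ℂ) 1, z ≠ 0 →
      α < (z * deriv f z / f z).re ∧ (z * deriv f z / f z).re < β)
    (g : ℂ → ℂ) (hg : DifferentiableOn ℂ g (ball 0 1)) (hg0 : g 0 = 0)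
    (hgf : ∀ z ∈ ball (0 : ℂ) 1, z ≠ 0 → Complex.exp (g z) = f z / z) :
    Subord g (Phat α β) := by
  have hπ := Real.pi_pos
  have hβα : 0 < β - α := by linarith
  have hα' : 0 < 1 - α := by linarith
  set K : ℝ := (β - α) / Real.pi with hK
  have hK0 : 0 < K := div_pos hβα hπ
  set θ : ℝ := 2 * Real.pi * (1 - α) / (β - α) with hθ
  have hθ0 : 0 < θ := by positivity
  have hθ1 : θ < 2 * Real.pi := by
    rw [hθ, div_lt_iff₀ hβα]
    nlinarith
  have hκ : (K : ℂ) * I ≠ 0 := mul_ne_zero (by exact_mod_cast hK0.ne') I_ne_zero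
  obtain ⟨Q, Q', hQ, hQ0, hQ', hQ'0, hinj, hcont⟩ :=
    exists_primitive_stripLog_div (norm_exp_ofReal_mul_I θ) (exp_ofReal_mul_I_ne_one hθ0 hθ1) hκ
  obtain ⟨ω, hω, hω0, hωmem, hgω⟩ := subord_of_mem_strip hθ0 hθ1 hκ hQ hQ0 (fun z _ => hQ' z)
    hQ'0 hinj hg hg0 fun z hz => by
      have hre : α - 1 < (z * deriv g z).re ∧ (z * deriv g z).re < β - 1 := by
        rcases eq_or_ne z 0 with rfl | hz0
        · simpa using ⟨hα, hβ⟩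
        · rw [mul_deriv_eq_of_exp_eq_div hf hg hgf hz hz0, sub_re, one_re]
          exact ⟨by linarith [(hS z hz hz0).1], by linarith [(hS z hz hz0).2]⟩
      have him : (z * deriv g z / (K * I)).im = -(z * deriv g z).re / K := by
        rw [mul_comm (K : ℂ) I, ← div_div, div_ofReal_im, div_I, neg_im, mul_I_im]
      have hθK : θ / 2 = (1 - α) / K := by rw [hθ, hK]; field_simp
      have hπK : Real.pi = (β - α) / K := by rw [hK]; field_simp
      rw [him, hθK, hπK, ← sub_div]
      constructor <;> gcongr <;> linarith
  refine ⟨ω, hω, hω0, hωmem, fun z hz => ?_⟩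
  rw [hgω z hz, Phat_eq_of_hasDerivAt hQ hQ0 (fun w hw => ?_) hcont (hωmem z hz)]
  rw [hQ', P_eq_stripLog hw, add_sub_cancel_left]
end

section
/- If f ∈ S(α,β) with α < 1 < β, then f(z)/z is subordinate to exp(P̂_{α,β}(z)) on the unit disc, where P̂_{α,β}(z) = ∫₀^z (P_{α,β}(t)-1)/t dt. -/
open Complex Metric

theorem hasDerivAt_norm_sq_comp {ω : ℂ → ℂ} {γ : ℝ → ℂ} {t : ℝ} {γ' : ℂ}
    (hω : DifferentiableAt ℂ ω (γ t)) (hγ : HasDerivAt γ γ' t) :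
    HasDerivAt (fun s => ‖ω (γ s)‖ ^ 2)
      (2 * ((starRingEnd ℂ) (ω (γ t)) * (γ' * deriv ω (γ t))).re) t := by
  have h := (hω.hasDerivAt.scomp t hγ).norm_sq
  simpa [Complex.inner, mul_comm] using h

/-- **Jack's lemma**. -/
theorem jack_lemma {ω : ℂ → ℂ} {s : ℝ} {z₀ : ℂ} (hs : 0 < s)
    (hω : ∀ z ∈ closedBall (0 : ℂ) s, DifferentiableAt ℂ ω z) (h0 : ω 0 = 0) (hz₀ : ‖z₀‖ = s)
    (hmax : ∀ z ∈ closedBall (0 : ℂ) s, ‖ω z‖ ≤ ‖ω z₀‖) (hne : ω z₀ ≠ 0) :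
    ∃ m : ℝ, 1 ≤ m ∧ z₀ * deriv ω z₀ = m * ω z₀ := by
  have hz₀' : z₀ ∈ closedBall (0 : ℂ) s := by simp [hz₀]
  have hpos : 0 < normSq (ω z₀) := normSq_pos.2 hne
  set A : ℂ := (starRingEnd ℂ) (ω z₀) * (z₀ * deriv ω z₀) with hA
  have him : A.im = 0 := by
    have hγ : HasDerivAt (fun t : ℝ => z₀ * exp (t * I)) (z₀ * I) 0 := by
      have h1 : HasDerivAt (fun t : ℝ => (t : ℂ) * I) (1 * I) 0 :=
        (Complex.ofRealCLM.hasDerivAt (x := (0 : ℝ))).mul_const I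
      simpa using (h1.cexp).const_mul z₀
    have hd := hasDerivAt_norm_sq_comp (ω := ω) (t := 0) (by simpa using hω z₀ hz₀') hγ
    have hm : IsLocalMax (fun t : ℝ => ‖ω (z₀ * exp (t * I))‖ ^ 2) 0 := by
      refine Filter.Eventually.of_forall fun t => ?_
      simp only [ofReal_zero, zero_mul, exp_zero, mul_one]
      gcongr
      exact hmax _ (by simp [hz₀, norm_exp_ofReal_mul_I])
    have h := hm.hasDerivAt_eq_zero hd
    simp only [ofReal_zero, zero_mul, exp_zero, mul_one] at h
    have e : (starRingEnd ℂ) (ω z₀) * (z₀ * I * deriv ω z₀) = A * I := by rw [hA]; ring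
    rw [e] at h
    simpa using h
  have hre : normSq (ω z₀) ≤ A.re := by
    have hγ : HasDerivAt (fun t : ℝ => (t : ℂ) * z₀) z₀ 1 := by
      simpa using (Complex.ofRealCLM.hasDerivAt (x := (1 : ℝ))).mul_const z₀
    have hd := hasDerivAt_norm_sq_comp (ω := ω) (t := 1) (by simpa using hω z₀ hz₀') hγ
    have hd2 := hd.sub ((hasDerivAt_pow 2 (1 : ℝ)).mul_const (‖ω z₀‖ ^ 2))
    have hT := (hasDerivAt_iff_tendsto_slope.1 hd2).mono_left
      (nhdsWithin_mono (1 : ℝ) (s := Set.Iio 1) fun x hx => ne_of_lt hx)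
    have h := ge_of_tendsto (b := 0) hT ?_
    · simp only [ofReal_one, one_mul] at h
      rw [← hA] at h
      rw [normSq_eq_norm_sq]
      norm_num at h
      linarith
    · have hev : Set.Ioo (0 : ℝ) 1 ∈ nhdsWithin (1 : ℝ) (Set.Iio 1) :=
        Ioo_mem_nhdsLT one_pos
      filter_upwards [hev] with t ht
      have hb : (t : ℂ) * z₀ ∈ ball (0 : ℂ) s := by
        simp only [mem_ball_zero_iff, norm_mul, norm_real, Real.norm_eq_abs, abs_of_pos ht.1, hz₀]
        nlinarith [ht.2]
      have hsch := dist_le_div_mul_dist_of_mapsTo_ball (f := ω) (c := 0) (R₁ := s)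
        (R₂ := ‖ω z₀‖) (z := t * z₀)
        (fun z hz => (hω z (ball_subset_closedBall hz)).differentiableWithinAt)
        (fun z hz => by simpa [h0] using hmax z (ball_subset_closedBall hz)) hb
      have hsch' : ‖ω (t * z₀)‖ ≤ t * ‖ω z₀‖ := by
        simp only [h0, dist_zero_right, norm_mul, norm_real, Real.norm_eq_abs, abs_of_pos ht.1,
          hz₀] at hsch
        calc _ ≤ _ := hsch
          _ = _ := by field_simp
      have h2 : ‖ω (t * z₀)‖ ^ 2 ≤ (t * ‖ω z₀‖) ^ 2 := by gcongr
      rw [slope_def_field]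
      apply div_nonneg_of_nonpos
      · simp
        linarith [mul_pow t ‖ω z₀‖ 2]
      · linarith [ht.2]
  refine ⟨A.re / normSq (ω z₀), (one_le_div hpos).2 hre, ?_⟩
  have hA' : A = (A.re : ℂ) := Complex.ext (by simp) (by simp [him])
  have hc : (starRingEnd ℂ) (ω z₀) ≠ 0 := by simpa using hne
  rw [ofReal_div, ← hA', ← mul_conj, hA]
  field_simp

/-- **Noshiro–Warschawski theorem** on a convex set. -/
theorem injOn_of_re_mul_deriv_pos {Q H : ℂ → ℂ} {U : Set ℂ} {c : ℂ} (hU : Convex ℝ U)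
    (hQ : ∀ z ∈ U, HasDerivAt Q (H z) z) (hpos : ∀ z ∈ U, 0 < (c * H z).re) : U.InjOn Q := by
  intro a ha b hb hab
  by_contra hne
  set d := b - a with hd
  have hd0 : d ≠ 0 := sub_ne_zero.2 (Ne.symm hne)
  have hmem : ∀ t ∈ Set.Icc (0 : ℝ) 1, a + t * d ∈ U := fun t ht => by
    simpa [hd] using hU.add_smul_sub_mem ha hb ht
  have hder : ∀ t ∈ Set.Icc (0 : ℝ) 1,
      HasDerivAt (fun t : ℝ => (c * (starRingEnd ℂ) d * Q (a + t * d)).re)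
        (normSq d * (c * H (a + t * d)).re) t := by
    intro t ht
    have h1 : HasDerivAt (fun t : ℝ => a + (t : ℂ) * d) d t := by
      simpa using ((Complex.ofRealCLM.hasDerivAt (x := t)).mul_const d).const_add a
    have h2 := ((hQ _ (hmem t ht)).scomp t h1).const_mul (c * (starRingEnd ℂ) d)
    have h3 := (Complex.reCLM.hasFDerivAt).comp_hasDerivAt t h2
    refine h3.congr_deriv ?_
    simp only [reCLM_apply, smul_eq_mul]
    rw [show c * (starRingEnd ℂ) d * (d * H (a + t * d)) = (d * (starRingEnd ℂ) d) *
      (c * H (a + t * d)) by ring, mul_conj, re_ofReal_mul]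
  have hmono := strictMonoOn_of_deriv_pos (convex_Icc (0 : ℝ) 1)
    (fun t ht => (hder t ht).continuousAt.continuousWithinAt) (fun t ht => by
      rw [interior_Icc] at ht
      have ht' := Set.Ioo_subset_Icc_self ht
      rw [(hder t ht').deriv]
      exact mul_pos (normSq_pos.2 hd0) (hpos _ (hmem t ht')))
  have h := hmono (Set.left_mem_Icc.2 zero_le_one) (Set.right_mem_Icc.2 zero_le_one) one_pos
  simp [hd, hab] at h

/-- A solution of `z ω'(z) H(ω(z)) = g(z)` is a Schwarz function if `w ↦ w * H w` has a left
inverse `k` for which all `z ↦ k (μ * g z)` with `μ ∈ (0, 1]` are Schwarz functions. -/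
theorem norm_le_of_starlike {ω H g k : ℂ → ℂ} {r : ℝ} (hr : r ≤ 1)
    (hω : DifferentiableOn ℂ ω (ball 0 r)) (h0 : ω 0 = 0)
    (hω1 : Set.MapsTo ω (ball 0 r) (ball 0 1))
    (hode : ∀ z ∈ ball (0 : ℂ) r, z * deriv ω z * H (ω z) = g z)
    (hk : ∀ w ∈ ball (0 : ℂ) 1, k (w * H w) = w)
    (hkg : ∀ μ : ℝ, 0 < μ → μ ≤ 1 → ∀ z ∈ ball (0 : ℂ) 1, ‖k (μ * g z)‖ ≤ ‖z‖)
    {z : ℂ} (hz : z ∈ ball (0 : ℂ) r) : ‖ω z‖ ≤ ‖z‖ := by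
  rcases eq_or_ne z 0 with rfl | hz0
  · simp [h0]
  set s := ‖z‖ with hs
  have hs0 : 0 < s := norm_pos_iff.2 hz0
  have hsr : s < r := by simpa using hz
  have hsub : closedBall (0 : ℂ) s ⊆ ball 0 r := closedBall_subset_ball hsr
  have hdiff : ∀ z ∈ closedBall (0 : ℂ) s, DifferentiableAt ℂ ω z := fun z hz =>
    hω.differentiableAt (isOpen_ball.mem_nhds (hsub hz))
  obtain ⟨z₀, hz₀f, hz₀⟩ := exists_mem_frontier_isMaxOn_norm (f := ω) (U := ball (0 : ℂ) s)
    isBounded_ball ⟨0, by simpa using hs0⟩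
    (DifferentiableOn.diffContOnCl (by
      rw [closure_ball _ hs0.ne']
      exact fun z hz => (hdiff z hz).differentiableWithinAt))
  rw [frontier_ball _ hs0.ne', mem_sphere_zero_iff_norm] at hz₀f
  rw [closure_ball _ hs0.ne'] at hz₀
  have hmax : ∀ z ∈ closedBall (0 : ℂ) s, ‖ω z‖ ≤ ‖ω z₀‖ := fun z hz => hz₀ hz
  refine (hmax z (by simp [hs])).trans ?_
  by_cases hne : ω z₀ = 0
  · simpa [hne] using hs0.le
  obtain ⟨m, hm, hmz⟩ := jack_lemma hs0 hdiff h0 hz₀f hmax hne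
  have hz₀r : z₀ ∈ ball (0 : ℂ) r := by simpa [hz₀f] using hsr
  have hm0 : (0 : ℝ) < m := by linarith
  have hmC : (m : ℂ) ≠ 0 := by exact_mod_cast hm0.ne'
  have he : ω z₀ * H (ω z₀) = ((m⁻¹ : ℝ) : ℂ) * g z₀ := by
    rw [← hode z₀ hz₀r, hmz]
    push_cast
    field_simp
  have h := hkg m⁻¹ (inv_pos.2 hm0) (inv_le_one_of_one_le₀ hm) z₀ (ball_subset_ball hr hz₀r)
  rwa [← he, hk _ (hω1 hz₀r), hz₀f] at h

/-- Subordination of antiderivatives: if `z q'(z)` is subordinate to `z Q'(z)` in the starlike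
sense below and `Q` is univalent, then `q` is subordinate to `Q`. -/
theorem subord_of_starlike {q Q H g k : ℂ → ℂ}
    (hQ : ∀ z ∈ ball (0 : ℂ) 1, HasDerivAt Q (H z) z) (hQ0 : Q 0 = 0)
    (hH : ∀ z ∈ ball (0 : ℂ) 1, H z ≠ 0) (hinj : (ball (0 : ℂ) 1).InjOn Q)
    (hq : DifferentiableOn ℂ q (ball 0 1)) (hq0 : q 0 = 0)
    (hqg : ∀ z ∈ ball (0 : ℂ) 1, z * deriv q z = g z)
    (hk : ∀ w ∈ ball (0 : ℂ) 1, k (w * H w) = w)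
    (hkg : ∀ μ : ℝ, 0 < μ → μ ≤ 1 → ∀ z ∈ ball (0 : ℂ) 1, ‖k (μ * g z)‖ ≤ ‖z‖) :
    ∃ ω : ℂ → ℂ, DifferentiableOn ℂ ω (ball 0 1) ∧ ω 0 = 0 ∧
      (∀ z ∈ ball (0 : ℂ) 1, ω z ∈ ball (0 : ℂ) 1) ∧
      ∀ z ∈ ball (0 : ℂ) 1, q z = Q (ω z) := by
  set D := ball (0 : ℂ) 1
  have h0D : (0 : ℂ) ∈ D := mem_ball_self one_pos
  set G := Function.invFunOn Q D
  have hGQ : ∀ z ∈ D, G (Q z) = z := fun z hz => hinj.leftInvOn_invFunOn hz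
  have hQd : DifferentiableOn ℂ Q D := fun z hz => (hQ z hz).differentiableAt.differentiableWithinAt
  have hmap : ∀ z ∈ D, Filter.map Q (nhds z) = nhds (Q z) := fun z hz => by
    have hs : HasStrictDerivAt Q (deriv Q z) z :=
      (hQd.analyticAt (isOpen_ball.mem_nhds hz)).hasStrictDerivAt
    exact hs.map_nhds_eq (by rw [(hQ z hz).deriv]; exact hH z hz)
  have hopen : IsOpen (Q '' D) := by
    rw [isOpen_iff_mem_nhds]
    rintro _ ⟨z, hz, rfl⟩
    rw [← hmap z hz]
    exact Filter.image_mem_map (isOpen_ball.mem_nhds hz)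
  have hGD : ∀ y ∈ Q '' D, G y ∈ D := by
    rintro _ ⟨z, hz, rfl⟩
    rwa [hGQ z hz]
  have hQG : ∀ y ∈ Q '' D, Q (G y) = y := by
    rintro _ ⟨z, hz, rfl⟩
    rw [hGQ z hz]
  have hGder : ∀ y ∈ Q '' D, HasDerivAt G (H (G y))⁻¹ y := by
    intro y hy
    have hcont : ContinuousAt G y := by
      obtain ⟨z, hz, rfl⟩ := hy
      rw [ContinuousAt, ← hmap z hz, Filter.tendsto_map'_iff, hGQ z hz]
      refine Filter.tendsto_id.congr' ?_
      filter_upwards [isOpen_ball.mem_nhds hz] with w hw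
      exact (hGQ w hw).symm
    exact HasDerivAt.of_local_left_inverse hcont (hQ _ (hGD y hy)) (hH _ (hGD y hy))
      (by filter_upwards [hopen.mem_nhds hy] with w hw using hQG w hw)
  have hω0 : G (q 0) = 0 := by rw [hq0]; simpa [hQ0] using hGQ 0 h0D
  have hder : ∀ z ∈ D, q z ∈ Q '' D →
      HasDerivAt (fun z => G (q z)) ((H (G (q z)))⁻¹ * deriv q z) z := fun z hz hqz =>
    (hGder _ hqz).comp z (hq.differentiableAt (isOpen_ball.mem_nhds hz)).hasDerivAt
  have hall : ∀ z ∈ D, q z ∈ Q '' D := by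
    by_contra! hcon
    obtain ⟨z₁, hz₁, hqz₁⟩ := hcon
    have hz₁1 : ‖z₁‖ < 1 := by simpa [D] using hz₁
    set K := closedBall (0 : ℂ) ‖z₁‖ ∩ q ⁻¹' (Q '' D)ᶜ
    have hKD : closedBall (0 : ℂ) ‖z₁‖ ⊆ D := closedBall_subset_ball hz₁1
    have hK : IsCompact K := by
      refine (isCompact_closedBall (0 : ℂ) ‖z₁‖).of_isClosed_subset ?_ Set.inter_subset_left
      exact (hq.continuousOn.mono hKD).preimage_isClosed_of_isClosed isClosed_closedBall
        hopen.isClosed_compl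
    obtain ⟨z₂, hz₂, hmin⟩ := hK.exists_isMinOn ⟨z₁, by simp, hqz₁⟩ continuous_norm.continuousOn
    have hz₂D : z₂ ∈ D := hKD hz₂.1
    have hz₂1 : ‖z₂‖ < 1 := by simpa [D] using hz₂D
    have hsub : ball (0 : ℂ) ‖z₂‖ ⊆ D := ball_subset_ball hz₂1.le
    have hin : ∀ z ∈ ball (0 : ℂ) ‖z₂‖, q z ∈ Q '' D := by
      intro z hz
      by_contra hqz
      have hzn : ‖z‖ < ‖z₂‖ := by simpa using hz
      have hz₂n : ‖z₂‖ ≤ ‖z₁‖ := by simpa using hz₂.1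
      have := hmin (show z ∈ K from ⟨by simpa using (hzn.trans_le hz₂n).le, hqz⟩)
      simp at this
      linarith
    have hbound : ∀ z ∈ ball (0 : ℂ) ‖z₂‖, ‖G (q z)‖ ≤ ‖z‖ := fun z hz =>
      norm_le_of_starlike (ω := fun z => G (q z)) (H := H) (g := g) (k := k) hz₂1.le
        (fun z hz => (hder z (hsub hz) (hin z hz)).differentiableAt.differentiableWithinAt) hω0
        (fun z hz => hGD _ (hin z hz))
        (fun z hz => by
          rw [(hder z (hsub hz) (hin z hz)).deriv, ← hqg z (hsub hz)]
          have := hH _ (hGD _ (hin z hz))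
          field_simp) hk hkg hz
    have hcl : IsClosed (Q '' closedBall (0 : ℂ) ‖z₂‖) :=
      ((isCompact_closedBall (0 : ℂ) ‖z₂‖).image_of_continuousOn
        (hQd.continuousOn.mono (closedBall_subset_ball hz₂1))).isClosed
    have hz₂0 : z₂ ≠ 0 := by
      rintro rfl
      exact hz₂.2 ⟨0, h0D, by rw [hQ0, hq0]⟩
    have hmaps : Set.MapsTo q (ball (0 : ℂ) ‖z₂‖) (Q '' closedBall (0 : ℂ) ‖z₂‖) := fun z hz =>
      ⟨G (q z), by
        have hzn : ‖z‖ < ‖z₂‖ := by simpa using hz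
        simpa using (hbound z hz).trans hzn.le, hQG _ (hin z hz)⟩
    have hmem : z₂ ∈ closure (ball (0 : ℂ) ‖z₂‖) := by
      rw [closure_ball _ (norm_ne_zero_iff.2 hz₂0)]; simp
    have := (hq.differentiableAt
      (isOpen_ball.mem_nhds hz₂D)).continuousAt.continuousWithinAt.mem_closure hmem hmaps
    rw [hcl.closure_eq] at this
    exact hz₂.2 (Set.image_mono (closedBall_subset_ball hz₂1) this)
  exact ⟨fun z => G (q z),
    fun z hz => (hder z hz (hall z hz)).differentiableAt.differentiableWithinAt, hω0,
    fun z hz => hGD _ (hall z hz), fun z hz => (hQG _ (hall z hz)).symm⟩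

/-- `z ↦ i log ((1 - e^{2iφ} z) / (1 - z))`, which maps the unit disc onto the strip
`-φ < Re u < π - φ`. -/
noncomputable def stripMap (φ : ℝ) (z : ℂ) : ℂ :=
  I * log ((1 - exp (2 * φ * I) * z) / (1 - z))

/-- The inverse of `stripMap φ`. -/
noncomputable def stripInv (φ : ℝ) (u : ℂ) : ℂ :=
  (exp (-(I * u)) - 1) / (exp (-(I * u)) - exp (2 * φ * I))

theorem sinh_le_mul_cosh {s : ℝ} (hs : 0 ≤ s) : Real.sinh s ≤ s * Real.cosh s := by
  have hder : ∀ t : ℝ, HasDerivAt (fun t => t * Real.cosh t - Real.sinh t) (t * Real.sinh t) t :=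
    fun t => by
      refine (((hasDerivAt_id t).mul (Real.hasDerivAt_cosh t)).sub
        (Real.hasDerivAt_sinh t)).congr_deriv ?_
      simp
  have hmono : MonotoneOn (fun t => t * Real.cosh t - Real.sinh t) (Set.Ici 0) := by
    refine monotoneOn_of_deriv_nonneg (convex_Ici 0)
      (fun t _ => (hder t).continuousAt.continuousWithinAt)
      (fun t _ => (hder t).differentiableAt.differentiableWithinAt) fun t ht => ?_
    rw [interior_Ici] at ht
    rw [(hder t).deriv]
    exact mul_nonneg (le_of_lt ht) (Real.sinh_nonneg_iff.2 (le_of_lt ht))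
  have := hmono Set.self_mem_Ici hs hs
  simp at this
  linarith

theorem two_mul_cosh_sub_one_le (y : ℝ) : 2 * (Real.cosh y - 1) ≤ y * Real.sinh y := by
  wlog hy : 0 ≤ y generalizing y
  · simpa using this (-y) (by linarith)
  have h1 := sinh_le_mul_cosh (s := y / 2) (by linarith)
  have h2 : 0 ≤ Real.sinh (y / 2) := Real.sinh_nonneg_iff.2 (by linarith)
  have h3 := Real.cosh_two_mul (y / 2)
  have h4 := Real.sinh_two_mul (y / 2)
  have h5 := Real.cosh_sq (y / 2)
  rw [mul_div_cancel₀ y (by norm_num : (2 : ℝ) ≠ 0)] at h3 h4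
  rw [h3, h4, h5]
  nlinarith

theorem mul_cos_lt_sin {φ : ℝ} (h0 : 0 < φ) (h1 : φ < Real.pi) :
    φ * Real.cos φ < Real.sin φ := by
  have hsin := Real.sin_pos_of_pos_of_lt_pi h0 h1
  rcases lt_or_ge φ (Real.pi / 2) with h | h
  · have hcos := Real.cos_pos_of_mem_Ioo ⟨by linarith, h⟩
    have := Real.lt_tan h0 h
    rwa [Real.tan_eq_sin_div_cos, lt_div_iff₀ hcos] at this
  · have := Real.cos_nonpos_of_pi_div_two_le_of_le h (by linarith)
    nlinarith

theorem strip_inequality {φ x y : ℝ} (h0 : 0 < φ) (h1 : φ < Real.pi) (hx0 : -φ < x)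
    (hx1 : x < Real.pi - φ) (hne : x ≠ 0 ∨ y ≠ 0) :
    0 < x * (Real.cos φ * Real.cosh y - Real.cos (x + φ)) + y * Real.sin φ * Real.sinh y := by
  have hsin := Real.sin_pos_of_pos_of_lt_pi h0 h1
  have hA : 0 < x * Real.cos φ + 2 * Real.sin φ := by
    rcases le_or_gt 0 (Real.cos φ) with hc | hc
    · nlinarith [mul_cos_lt_sin h0 h1]
    · have := mul_cos_lt_sin (φ := Real.pi - φ) (by linarith) (by linarith)
      rw [Real.cos_pi_sub, Real.sin_pi_sub] at this
      nlinarith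
  have hB := mul_le_mul_of_nonneg_left (two_mul_cosh_sub_one_le y) hsin.le
  have hC : x ≠ 0 → 0 < x * (Real.cos φ - Real.cos (x + φ)) := fun hx => by
    rcases lt_or_gt_of_ne hx with h | h
    · exact mul_pos_of_neg_of_neg h (by
        linarith [Real.cos_lt_cos_of_nonneg_of_le_pi (x := x + φ) (y := φ) (by linarith) h1.le
          (by linarith)])
    · exact mul_pos h (by
        linarith [Real.cos_lt_cos_of_nonneg_of_le_pi (x := φ) (y := x + φ) h0.le (by linarith)
          (by linarith)])
  have hD : 0 ≤ (Real.cosh y - 1) * (x * Real.cos φ + 2 * Real.sin φ) :=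
    mul_nonneg (by linarith [Real.one_le_cosh y]) hA.le
  by_cases hx : x = 0
  · have hy : y ≠ 0 := by tauto
    have := mul_pos (sub_pos.2 (Real.one_lt_cosh.2 hy)) hA
    subst hx
    simp only [zero_mul, zero_add] at this ⊢
    nlinarith
  · nlinarith [hC hx]

theorem exp_neg_I_mul_eq (u : ℂ) : exp (-(I * u)) =
    ⟨Real.exp u.im * Real.cos u.re, -(Real.exp u.im * Real.sin u.re)⟩ := by
  apply Complex.ext <;> simp [exp_re, exp_im]

theorem exp_two_mul_I_eq (φ : ℝ) : exp (2 * φ * I) =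
    ⟨Real.cos φ ^ 2 - Real.sin φ ^ 2, 2 * Real.sin φ * Real.cos φ⟩ := by
  apply Complex.ext
  · simp [exp_re, Real.cos_two_mul']
  · simp [exp_im, Real.sin_two_mul]

theorem exp_neg_mul_I_eq (φ : ℝ) : exp (-φ * I) = ⟨Real.cos φ, -Real.sin φ⟩ := by
  apply Complex.ext <;> simp [exp_re, exp_im]

theorem normSq_exp_sub (φ : ℝ) (u : ℂ) :
    normSq (exp (-(I * u)) - exp (2 * φ * I)) - normSq (exp (-(I * u)) - 1) =
      4 * Real.exp u.im * Real.sin (φ + u.re) * Real.sin φ := by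
  rw [exp_neg_I_mul_eq, exp_two_mul_I_eq, Real.sin_add]
  simp only [normSq_apply, sub_re, sub_im, one_re, one_im]
  linear_combination (Real.sin φ ^ 2 + Real.cos φ ^ 2 + 1 -
    2 * Real.exp u.im * Real.cos u.re) * Real.sin_sq_add_cos_sq φ

theorem exp_two_mul_ne_one {φ : ℝ} (h0 : 0 < φ) (h1 : φ < Real.pi) : exp (2 * φ * I) ≠ 1 := by
  intro h
  have h2 := congrArg re h
  simp only [exp_re, mul_re, mul_im, I_re, I_im, ofReal_re, ofReal_im, re_ofNat, im_ofNat,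
    one_re] at h2
  norm_num [Real.cos_two_mul] at h2
  nlinarith [Real.sin_pos_of_pos_of_lt_pi h0 h1, Real.sin_sq_add_cos_sq φ]

theorem norm_exp_two_mul (φ : ℝ) : ‖exp (2 * φ * I)‖ = 1 := by
  simpa using norm_exp_ofReal_mul_I (2 * φ)

theorem one_sub_ne_zero_of_mem_ball {w : ℂ} (hw : ‖w‖ < 1) : 1 - w ≠ 0 := by
  intro h
  rw [← sub_eq_zero.1 h] at hw
  simp at hw

section StripMap

variable {φ : ℝ} {z : ℂ}

theorem quotient_ne_zero (hz : ‖z‖ < 1) : (1 - exp (2 * φ * I) * z) / (1 - z) ≠ 0 :=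
  div_ne_zero (one_sub_ne_zero_of_mem_ball (by rwa [norm_mul, norm_exp_two_mul, one_mul]))
    (one_sub_ne_zero_of_mem_ball hz)

theorem exp_neg_stripMap (hz : ‖z‖ < 1) :
    exp (-(I * stripMap φ z)) = (1 - exp (2 * φ * I) * z) / (1 - z) := by
  rw [stripMap, ← mul_assoc, I_mul_I, neg_one_mul, neg_neg, exp_log (quotient_ne_zero hz)]

theorem mul_exp_neg_stripMap_sub (hz : ‖z‖ < 1) :
    z * (exp (-(I * stripMap φ z)) - exp (2 * φ * I)) = exp (-(I * stripMap φ z)) - 1 := by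
  rw [exp_neg_stripMap hz]
  have := one_sub_ne_zero_of_mem_ball hz
  field_simp
  ring

theorem exp_neg_stripMap_sub_ne_zero (h0 : 0 < φ) (h1 : φ < Real.pi) (hz : ‖z‖ < 1) :
    exp (-(I * stripMap φ z)) - exp (2 * φ * I) ≠ 0 := by
  intro h
  have h2 := mul_exp_neg_stripMap_sub (φ := φ) hz
  rw [h, mul_zero] at h2
  exact exp_two_mul_ne_one h0 h1 (by linear_combination -h - h2)

theorem stripInv_stripMap (h0 : 0 < φ) (h1 : φ < Real.pi) (hz : ‖z‖ < 1) :
    stripInv φ (stripMap φ z) = z := by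
  rw [stripInv, ← mul_exp_neg_stripMap_sub hz,
    mul_div_cancel_right₀ _ (exp_neg_stripMap_sub_ne_zero h0 h1 hz)]

theorem stripMap_re : (stripMap φ z).re = -arg ((1 - exp (2 * φ * I) * z) / (1 - z)) := by
  simp [stripMap, log_im]

theorem stripMap_re_mem (h0 : 0 < φ) (h1 : φ < Real.pi) (hz : ‖z‖ < 1) :
    (stripMap φ z).re ∈ Set.Ioo (-φ) (Real.pi - φ) := by
  have hlt : normSq (exp (-(I * stripMap φ z)) - 1) <
      normSq (exp (-(I * stripMap φ z)) - exp (2 * φ * I)) := by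
    have hpos := normSq_pos.2 (exp_neg_stripMap_sub_ne_zero h0 h1 hz)
    rw [← mul_exp_neg_stripMap_sub hz, map_mul, normSq_eq_norm_sq z]
    exact mul_lt_of_lt_one_left hpos (pow_lt_one₀ (norm_nonneg z) hz two_ne_zero)
  rw [← sub_pos, normSq_exp_sub] at hlt
  have hs : 0 < Real.sin (φ + (stripMap φ z).re) :=
    pos_of_mul_pos_right (pos_of_mul_pos_left hlt
      (Real.sin_pos_of_pos_of_lt_pi h0 h1).le) (by positivity)
  have ha := arg_le_pi ((1 - exp (2 * φ * I) * z) / (1 - z))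
  have hb := neg_pi_lt_arg ((1 - exp (2 * φ * I) * z) / (1 - z))
  have hre := stripMap_re (φ := φ) (z := z)
  constructor
  · by_contra! h
    linarith [Real.sin_nonpos_of_nonpos_of_neg_pi_le (x := φ + (stripMap φ z).re) (by linarith)
      (by linarith)]
  · by_contra! h
    have := Real.sin_nonneg_of_nonneg_of_le_pi (x := φ + (stripMap φ z).re - Real.pi)
      (by linarith) (by linarith)
    rw [Real.sin_sub_pi] at this
    linarith

theorem quotient_mem_slitPlane (h0 : 0 < φ) (h1 : φ < Real.pi) (hz : ‖z‖ < 1) :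
    (1 - exp (2 * φ * I) * z) / (1 - z) ∈ slitPlane := by
  rw [mem_slitPlane_iff_arg]
  refine ⟨fun h => ?_, quotient_ne_zero hz⟩
  have := (stripMap_re_mem h0 h1 hz).1
  rw [stripMap_re, h] at this
  linarith

theorem differentiableOn_stripMap (h0 : 0 < φ) (h1 : φ < Real.pi) :
    DifferentiableOn ℂ (stripMap φ) (ball 0 1) := by
  intro z hz
  have hz' : ‖z‖ < 1 := by simpa using hz
  have hq : DifferentiableAt ℂ (fun z => (1 - exp (2 * φ * I) * z) / (1 - z)) z := by
    fun_prop (disch := exact one_sub_ne_zero_of_mem_ball hz')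
  exact ((hq.clog (quotient_mem_slitPlane h0 h1 hz')).const_mul I).differentiableWithinAt

theorem hasDerivAt_stripMap_zero : HasDerivAt (stripMap φ) (I * (1 - exp (2 * φ * I))) 0 := by
  have h1 : HasDerivAt (fun z : ℂ => 1 - exp (2 * φ * I) * z) (-exp (2 * φ * I)) 0 := by
    simpa using ((hasDerivAt_id (0 : ℂ)).const_mul (exp (2 * φ * I))).const_sub 1
  have h2 : HasDerivAt (fun z : ℂ => 1 - z) (-1) 0 := by
    simpa using (hasDerivAt_id (0 : ℂ)).const_sub 1
  have h3 := (((h1.div h2 (by simp)).clog (by simp)).const_mul I)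
  refine h3.congr_deriv ?_
  simp
  ring

theorem stripMap_zero : stripMap φ 0 = 0 := by simp [stripMap]

theorem re_exp_mul_stripMap_div_pos (h0 : 0 < φ) (h1 : φ < Real.pi) (hz : ‖z‖ < 1)
    (hz0 : z ≠ 0) : 0 < (exp (-φ * I) * (stripMap φ z / z)).re := by
  obtain ⟨hx0, hx1⟩ := stripMap_re_mem h0 h1 hz
  have hd := exp_neg_stripMap_sub_ne_zero h0 h1 hz
  have hm := mul_exp_neg_stripMap_sub (φ := φ) hz
  set u := stripMap φ z
  have hn : exp (-(I * u)) - 1 ≠ 0 := by rw [← hm]; exact mul_ne_zero hz0 hd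
  have hu : u.re ≠ 0 ∨ u.im ≠ 0 := by
    by_contra! h
    have : u = 0 := Complex.ext h.1 h.2
    simp [this] at hn
  have hpos := strip_inequality h0 h1 hx0 hx1 hu
  have hN := normSq_pos.2 hn
  have e1 : exp (-φ * I) * (u / z) = ((normSq (exp (-(I * u)) - 1))⁻¹ : ℝ) *
      (exp (-φ * I) * u * (exp (-(I * u)) - exp (2 * φ * I)) *
        (starRingEnd ℂ) (exp (-(I * u)) - 1)) := by
    have hc : (starRingEnd ℂ) (exp (-(I * u)) - 1) ≠ 0 := by
      rwa [Ne, map_eq_zero]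
    have hz' : z = (exp (-(I * u)) - 1) / (exp (-(I * u)) - exp (2 * φ * I)) :=
      (eq_div_iff hd).2 hm
    rw [ofReal_inv, ← mul_conj, hz']
    field_simp
  have e2 : (exp (-φ * I) * u * (exp (-(I * u)) - exp (2 * φ * I)) *
        (starRingEnd ℂ) (exp (-(I * u)) - 1)).re = 2 * Real.exp u.im *
      (u.re * (Real.cos φ * Real.cosh u.im - Real.cos (u.re + φ)) +
        u.im * Real.sin φ * Real.sinh u.im) := by
    have hC : 2 * Real.exp u.im * Real.cosh u.im = Real.exp u.im ^ 2 + 1 := by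
      rw [Real.cosh_eq, Real.exp_neg]
      field_simp
    have hS : 2 * Real.exp u.im * Real.sinh u.im = Real.exp u.im ^ 2 - 1 := by
      rw [Real.sinh_eq, Real.exp_neg]
      field_simp
    rw [exp_neg_I_mul_eq, exp_two_mul_I_eq, exp_neg_mul_I_eq, Real.cos_add]
    simp only [mul_re, mul_im, sub_re, sub_im, one_re, one_im, conj_re, conj_im]
    generalize Real.exp u.im = E at *
    linear_combination E ^ 2 * (u.re * Real.cos φ + u.im * Real.sin φ) *
        Real.sin_sq_add_cos_sq u.re +
      (u.re * (Real.cos φ * (1 - E * Real.cos u.re) + Real.sin φ * E * Real.sin u.re) -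
        u.im * (Real.sin φ * (1 - E * Real.cos u.re) - Real.cos φ * E * Real.sin u.re)) *
        Real.sin_sq_add_cos_sq φ -
      u.re * Real.cos φ * hC - u.im * Real.sin φ * hS
  rw [e1, re_ofReal_mul, e2]
  positivity

theorem stripInv_denom_ne_zero_and_norm_lt_one {u : ℂ} (h0 : 0 < φ) (h1 : φ < Real.pi)
    (hu : u.re ∈ Set.Ioo (-φ) (Real.pi - φ)) :
    exp (-(I * u)) - exp (2 * φ * I) ≠ 0 ∧ ‖stripInv φ u‖ < 1 := by
  have hs : 0 < Real.sin (φ + u.re) :=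
    Real.sin_pos_of_pos_of_lt_pi (by linarith [hu.1]) (by linarith [hu.2])
  have hs' := Real.sin_pos_of_pos_of_lt_pi h0 h1
  have h : 0 < 4 * Real.exp u.im * Real.sin (φ + u.re) * Real.sin φ := by positivity
  rw [← normSq_exp_sub, sub_pos] at h
  have hd : 0 < normSq (exp (-(I * u)) - exp (2 * φ * I)) := (normSq_nonneg _).trans_lt h
  refine ⟨normSq_pos.1 hd, ?_⟩
  rw [normSq_eq_norm_sq, normSq_eq_norm_sq] at h
  rw [stripInv, norm_div, div_lt_one (norm_pos_iff.2 (normSq_pos.1 hd))]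
  exact lt_of_pow_lt_pow_left₀ 2 (norm_nonneg _) h

end StripMap

/-- A zero-free holomorphic function on a disc has a holomorphic logarithm. -/
theorem exists_log_of_ne_zero {F : ℂ → ℂ} {r : ℝ} (hr : 0 < r)
    (hF : DifferentiableOn ℂ F (ball 0 r)) (hF0 : F 0 = 1) (hne : ∀ z ∈ ball (0 : ℂ) r, F z ≠ 0) :
    ∃ L : ℂ → ℂ, (∀ z ∈ ball (0 : ℂ) r, HasDerivAt L (deriv F z / F z) z) ∧ L 0 = 0 ∧
      ∀ z ∈ ball (0 : ℂ) r, exp (L z) = F z := by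
  have h0 : (0 : ℂ) ∈ ball (0 : ℂ) r := mem_ball_self hr
  obtain ⟨L, hL⟩ := ((hF.deriv isOpen_ball).div hF hne).isExactOn_ball
  have hL' : ∀ z ∈ ball (0 : ℂ) r, HasDerivAt (fun z => L z - L 0) (deriv F z / F z) z :=
    fun z hz => (hL z hz).sub_const _
  refine ⟨fun z => L z - L 0, hL', sub_self _, fun z hz => ?_⟩
  have hder : ∀ z ∈ ball (0 : ℂ) r,
      HasDerivAt (fun z => F z * exp (-(L z - L 0))) 0 z := fun z hz => by
    refine ((hF.differentiableAt (isOpen_ball.mem_nhds hz)).hasDerivAt.mul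
      (hL' z hz).neg.cexp).congr_deriv ?_
    have := hne z hz
    field_simp
    ring
  have hc := isOpen_ball.is_const_of_deriv_eq_zero (convex_ball (0 : ℂ) r).isPreconnected
    (fun z hz => (hder z hz).differentiableAt.differentiableWithinAt)
    (fun z hz => (hder z hz).deriv) hz h0
  simp only [sub_self, neg_zero, exp_zero, hF0, mul_one] at hc
  rw [exp_neg] at hc
  exact ((mul_inv_eq_one₀ (exp_ne_zero _)).1 hc).symm

theorem P_sub_one (α β : ℝ) (z : ℂ) :
    P α β z - 1 = ((β - α) / Real.pi : ℝ) *
      stripMap (Real.pi * (1 - α) / (β - α)) z := by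
  have e : (2 * Real.pi * I * (1 - (α : ℂ)) / ((β : ℂ) - α)) =
      2 * ((Real.pi * (1 - α) / (β - α) : ℝ) : ℂ) * I := by
    push_cast
    ring
  rw [P, stripMap, e]
  push_cast
  ring

theorem Phat_eq {α β : ℝ} {Q H : ℂ → ℂ} (hQ : ∀ z ∈ ball (0 : ℂ) 1, HasDerivAt Q (H z) z)
    (hQ0 : Q 0 = 0) (hH : ContinuousOn H (ball 0 1))
    (hP : ∀ z ∈ ball (0 : ℂ) 1, z * H z = P α β z - 1) {z : ℂ} (hz : z ∈ ball (0 : ℂ) 1) :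
    Phat α β z = Q z := by
  rcases eq_or_ne z 0 with rfl | hz0
  · simp [Phat, hQ0]
  have hmem : ∀ t ∈ Set.Icc (0 : ℝ) 1, (t : ℂ) * z ∈ ball (0 : ℂ) 1 := fun t ht => by
    simpa using (convex_ball (0 : ℂ) 1).smul_mem_of_zero_mem (mem_ball_self one_pos) hz ht
  have h1 : Phat α β z = ∫ t in (0 : ℝ)..1, H (t * z) * z := by
    refine intervalIntegral.integral_congr_ae (Filter.Eventually.of_forall fun t ht => ?_)
    rw [Set.uIoc_of_le zero_le_one] at ht
    have ht0 : (t : ℂ) ≠ 0 := by exact_mod_cast ht.1.ne'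
    rw [← hP _ (hmem t ⟨ht.1.le, ht.2⟩), mul_div_cancel_left₀ _ (mul_ne_zero ht0 hz0)]
  rw [h1, intervalIntegral.integral_eq_sub_of_hasDerivAt (f := fun t : ℝ => Q (t * z))]
  · simp [hQ0]
  · intro t ht
    rw [Set.uIcc_of_le zero_le_one] at ht
    have hγ : HasDerivAt (fun t : ℝ => (t : ℂ) * z) z t := by
      simpa using (Complex.ofRealCLM.hasDerivAt (x := t)).mul_const z
    exact ((hQ _ (hmem t ht)).scomp t hγ).congr_deriv (mul_comm _ _)
  · refine ContinuousOn.intervalIntegrable ?_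
    rw [Set.uIcc_of_le zero_le_one]
    exact (hH.comp (by fun_prop) hmem).mul continuousOn_const

theorem re_exp_mul_dslope_stripMap_pos {φ : ℝ} (h0 : 0 < φ) (h1 : φ < Real.pi) {z : ℂ}
    (hz : ‖z‖ < 1) : 0 < (exp (-φ * I) * dslope (stripMap φ) 0 z).re := by
  rcases eq_or_ne z 0 with rfl | hz0
  · rw [dslope_same, hasDerivAt_stripMap_zero.deriv, exp_neg_mul_I_eq, exp_two_mul_I_eq]
    simp only [mul_re, mul_im, sub_re, sub_im, one_re, one_im, I_re, I_im]
    have hs := Real.sin_pos_of_pos_of_lt_pi h0 h1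
    nlinarith [Real.sin_sq_add_cos_sq φ]
  · simpa [dslope_of_ne _ hz0, slope_def_field, stripMap_zero] using
      re_exp_mul_stripMap_div_pos h0 h1 hz hz0

theorem norm_stripInv_le {φ : ℝ} (h0 : 0 < φ) (h1 : φ < Real.pi) {v : ℂ → ℂ}
    (hv : DifferentiableOn ℂ v (ball 0 1)) (hv0 : v 0 = 0)
    (hre : ∀ z ∈ ball (0 : ℂ) 1, (v z).re ∈ Set.Ioo (-φ) (Real.pi - φ)) {z : ℂ}
    (hz : z ∈ ball (0 : ℂ) 1) : ‖stripInv φ (v z)‖ ≤ ‖z‖ := by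
  refine norm_le_norm_of_mapsTo_ball (f := fun z => stripInv φ (v z)) (R := 1) ?_ ?_ ?_
    (by simpa using hz)
  · exact ((hv.const_mul I).neg.cexp.sub_const 1).div
      ((hv.const_mul I).neg.cexp.sub_const _) fun z hz =>
        (stripInv_denom_ne_zero_and_norm_lt_one h0 h1 (hre z hz)).1
  · exact fun z hz => by simpa using (stripInv_denom_ne_zero_and_norm_lt_one h0 h1 (hre z hz)).2.le
  · simp [stripInv, hv0]

/-- If `f ∈ S(α,β)` then `f(z)/z ≺ exp(P̂_{α,β}(z))`, where `F` is the analytic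
extension of `z ↦ f(z)/z` with `F 0 = 1`. -/
theorem f_div_z_subordinate_exp_Phat (α β : ℝ) (hα : α < 1) (hβ : 1 < β)
    (f : ℂ → ℂ) (hf : DifferentiableOn ℂ f (ball 0 1))
    (hf0 : f 0 = 0) (hf1 : deriv f 0 = 1)
    (hfz : ∀ z ∈ ball (0 : ℂ) 1, z ≠ 0 → f z ≠ 0)
    (hS : ∀ z ∈ ball (0 : ℂ) 1, z ≠ 0 →
      α < (z * deriv f z / f z).re ∧ (z * deriv f z / f z).re < β)
    (F : ℂ → ℂ) (hF : DifferentiableOn ℂ F (ball 0 1)) (hF0 : F 0 = 1)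
    (hFf : ∀ z ∈ ball (0 : ℂ) 1, z ≠ 0 → F z = f z / z) :
    Subord F (fun z => Complex.exp (Phat α β z)) := by
  have hβα : 0 < β - α := by linarith
  have hπ := Real.pi_pos
  set φ : ℝ := Real.pi * (1 - α) / (β - α) with hφ
  set c : ℝ := (β - α) / Real.pi with hc
  have hφ0 : 0 < φ := by
    have := sub_pos.2 hα
    positivity
  have hφ1 : φ < Real.pi := by
    rw [hφ, div_lt_iff₀ hβα]
    nlinarith
  have hc0 : 0 < c := by positivity
  have hcφ : c * φ = 1 - α := by rw [hφ, hc]; field_simp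
  have hcπ : c * Real.pi = β - α := by rw [hc]; field_simp
  have hcC : (c : ℂ) ≠ 0 := by exact_mod_cast hc0.ne'
  have h0 : (0 : ℂ) ∈ ball (0 : ℂ) 1 := mem_ball_self one_pos
  have hFne : ∀ z ∈ ball (0 : ℂ) 1, F z ≠ 0 := fun z hz => by
    rcases eq_or_ne z 0 with rfl | hz0
    · simp [hF0]
    · rw [hFf z hz hz0]
      exact div_ne_zero (hfz z hz hz0) hz0
  obtain ⟨L, hL, hL0, hLF⟩ := exists_log_of_ne_zero one_pos hF hF0 hFne
  set g : ℂ → ℂ := fun z => z * (deriv F z / F z) with hg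
  have hgd : DifferentiableOn ℂ g (ball 0 1) :=
    differentiableOn_id.mul ((hF.deriv isOpen_ball).div hF hFne)
  have hgre : ∀ z ∈ ball (0 : ℂ) 1, α - 1 < (g z).re ∧ (g z).re < β - 1 := by
    intro z hz
    rcases eq_or_ne z 0 with rfl | hz0
    · simp [hg, hα, hβ]
    have hzF : f =ᶠ[nhds z] fun w => w * F w := by
      filter_upwards [isOpen_ball.mem_nhds hz, isOpen_ne.mem_nhds hz0] with w hw hw0
      rw [hFf w hw hw0, mul_div_cancel₀ _ hw0]
    have hd := (hasDerivAt_id z).mul (hF.differentiableAt (isOpen_ball.mem_nhds hz)).hasDerivAt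
    have hdf : deriv f z = F z + z * deriv F z := by
      rw [hzF.deriv_eq]
      exact (hd.congr_deriv (by simp)).deriv
    have hquot : z * deriv f z / f z = g z + 1 := by
      rw [hdf, hzF.eq_of_nhds, hg]
      have := hFne z hz
      field_simp
      ring
    have h := hS z hz hz0
    rw [hquot, add_re, one_re] at h
    constructor <;> linarith [h.1, h.2]
  set H : ℂ → ℂ := fun z => c * dslope (stripMap φ) 0 z with hH
  have hHd : DifferentiableOn ℂ H (ball 0 1) :=
    ((differentiableOn_dslope (isOpen_ball.mem_nhds h0)).2
      (differentiableOn_stripMap hφ0 hφ1)).const_mul _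
  have hHmul : ∀ z, z * H z = c * stripMap φ z := fun z => by
    have := sub_smul_dslope (stripMap φ) 0 z
    rw [stripMap_zero, sub_zero, sub_zero, smul_eq_mul] at this
    rw [hH, ← this]
    ring
  have hHpos : ∀ z ∈ ball (0 : ℂ) 1, 0 < (exp (-φ * I) * H z).re := fun z hz => by
    have := re_exp_mul_dslope_stripMap_pos hφ0 hφ1 (z := z) (by simpa using hz)
    rw [hH, mul_left_comm, re_ofReal_mul]
    exact mul_pos hc0 this
  obtain ⟨Q₀, hQ₀⟩ := hHd.isExactOn_ball
  have hQ : ∀ z ∈ ball (0 : ℂ) 1, HasDerivAt (fun z => Q₀ z - Q₀ 0) (H z) z := fun z hz =>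
    (hQ₀ z hz).sub_const _
  obtain ⟨ω, hω, hω0, hωb, hωL⟩ := subord_of_starlike (q := L) (g := g)
    (k := fun v => stripInv φ (v / c)) hQ (sub_self _)
    (fun z hz h => by simpa [h] using hHpos z hz)
    (injOn_of_re_mul_deriv_pos (convex_ball 0 1) hQ hHpos)
    (fun z hz => (hL z hz).differentiableAt.differentiableWithinAt) hL0
    (fun z hz => by rw [(hL z hz).deriv])
    (fun w hw => by
      simp only [hHmul, mul_div_cancel_left₀ _ hcC]
      exact stripInv_stripMap hφ0 hφ1 (by simpa using hw))
    (fun μ hμ0 hμ1 z hz => norm_stripInv_le hφ0 hφ1 (v := fun z => μ * g z / c)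
      ((hgd.const_mul _).div_const _) (by simp [hg]) (fun w hw => by
        obtain ⟨hl, hu⟩ := hgre w hw
        rw [div_ofReal_re, re_ofReal_mul, Set.mem_Ioo, lt_div_iff₀ hc0, div_lt_iff₀ hc0]
        constructor <;> nlinarith) hz)
  refine ⟨ω, hω, hω0, hωb, fun z hz => ?_⟩
  simp only
  rw [Phat_eq hQ (sub_self _) hHd.continuousOn (fun w _ => by rw [hHmul, P_sub_one]) (hωb z hz),
    ← hωL z hz, hLF z hz]
end

section
/- If f ∈ S(α,β) with α < 1 < β, then the logarithmic coefficients γ_n of f satisfy Σ_{n=1}^∞ |γ_n|² ≤ ((β-α)²/(4π²)) (π⁴/45 - Li₄(e^{-2πi(1-α)/(β-α)}) - Li₄(e^{2πi(1-α)/(β-α)})), where Li₄(z) = Σ_{n≥1} zⁿ/n⁴. -/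
open Complex Metric

/-- The polylogarithm of order 4, `Li₄(z) = Σ_{n≥1} zⁿ/n⁴`. -/
noncomputable def Li4 (z : ℂ) : ℂ := ∑' n : ℕ, z ^ (n + 1) / ((n : ℂ) + 1) ^ 4

theorem differentiableOn_tsum_mul_pow {a : ℕ → ℂ}
    (ha : ∀ z ∈ ball (0 : ℂ) 1, Summable fun k => a k * z ^ k) :
    DifferentiableOn ℂ (fun z => ∑' k, a k * z ^ k) (ball 0 1) := by
  intro z hz
  obtain ⟨ρ, hzρ, hρ⟩ := exists_between (mem_ball_zero_iff.1 hz)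
  have hρ0 : 0 ≤ ρ := (norm_nonneg z).trans hzρ.le
  have hsum : Summable fun k => ‖a k‖ * ρ ^ k := by
    have := (ha (ρ : ℂ) (by simpa [abs_of_nonneg hρ0] using hρ)).norm
    simpa [abs_of_nonneg hρ0] using this
  have hd := differentiableOn_tsum_of_summable_norm (U := ball (0 : ℂ) ρ) hsum
    (F := fun k z => a k * z ^ k) (fun k => by fun_prop) isOpen_ball (fun k w hw => by
      rw [norm_mul, norm_pow]
      have := (mem_ball_zero_iff.1 hw).le
      gcongr)
  exact (hd.differentiableAt (isOpen_ball.mem_nhds (by simpa using hzρ))).differentiableWithinAt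

/-- A convergent power series is its truncation plus `z ^ n` times a holomorphic function. -/
theorem exists_differentiableOn_eq_sum_add_pow_mul {a : ℕ → ℂ} {g : ℂ → ℂ}
    (ha : ∀ z ∈ ball (0 : ℂ) 1, HasSum (fun k => a k * z ^ k) (g z)) (n : ℕ) :
    ∃ R : ℂ → ℂ, DifferentiableOn ℂ R (ball 0 1) ∧
      ∀ z ∈ ball (0 : ℂ) 1, g z = ∑ k ∈ Finset.range n, a k * z ^ k + z ^ n * R z := by
  have hs : ∀ z ∈ ball (0 : ℂ) 1, Summable fun k => a (k + n) * z ^ k := by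
    intro z hz
    rcases eq_or_ne z 0 with rfl | h0
    · exact summable_of_ne_finset_zero (s := {0}) fun k hk => by
        simp only [Finset.mem_singleton] at hk
        simp [hk]
    · have := ((summable_nat_add_iff n).2 (ha z hz).summable).mul_left ((z ^ n)⁻¹)
      refine this.congr fun k => ?_
      field_simp
      ring
  refine ⟨_, differentiableOn_tsum_mul_pow hs, fun z hz => ?_⟩
  rw [← (ha z hz).tsum_eq, ← (ha z hz).summable.sum_add_tsum_nat_add n, ← tsum_mul_left]
  congr 1
  exact tsum_congr fun k => by ring

theorem circleIntegrable_of_continuousOn_ball {E : Type*} [NormedAddCommGroup E] {F : ℂ → E}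
    {r : ℝ} (hF : ContinuousOn F (ball 0 1)) (hr : |r| < 1) : CircleIntegrable F 0 r :=
  (hF.mono (sphere_subset_closedBall.trans (closedBall_subset_ball hr))).circleIntegrable'

/-- The quadratic mean of `a + F` when `F` vanishes at the centre. -/
theorem circleAverage_norm_sq_const_add {F : ℂ → ℂ} {r : ℝ}
    (hF : DifferentiableOn ℂ F (ball 0 1)) (hF0 : F 0 = 0) (hr : |r| < 1) (a : ℂ) :
    Real.circleAverage (fun z => ‖a + F z‖ ^ 2) 0 r =
      ‖a‖ ^ 2 + Real.circleAverage (fun z => ‖F z‖ ^ 2) 0 r := by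
  have hmean : Real.circleAverage (fun z => 2 * starRingEnd ℂ a * F z) 0 r = 0 := by
    have hG : DifferentiableOn ℂ (fun z => 2 * starRingEnd ℂ a * F z) (ball 0 1) :=
      hF.const_mul _
    rw [circleAverage_of_differentiable_on_off_countable Set.countable_empty
      (hG.continuousOn.mono (closedBall_subset_ball hr))
      (fun z hz => (hG.differentiableAt (isOpen_ball.mem_nhds
        (ball_subset_ball hr.le hz.1)))), hF0, mul_zero]
  have hmean' : Real.circleAverage (fun z => (2 * starRingEnd ℂ a * F z).re) 0 r = 0 := by
    have := Complex.reCLM.circleAverage_comp_comm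
      (circleIntegrable_of_continuousOn_ball (F := fun z => 2 * starRingEnd ℂ a * F z)
        (hF.const_mul _).continuousOn hr)
    simpa [hmean, Function.comp_def] using this
  have hi : CircleIntegrable (fun z => (2 * starRingEnd ℂ a * F z).re) 0 r :=
    circleIntegrable_of_continuousOn_ball
      (Complex.continuous_re.comp_continuousOn (hF.const_mul _).continuousOn) hr
  have hi' : CircleIntegrable (fun z => ‖F z‖ ^ 2) 0 r :=
    circleIntegrable_of_continuousOn_ball (hF.continuousOn.norm.pow 2) hr
  have : (fun z => ‖a + F z‖ ^ 2) =
      (fun _ => ‖a‖ ^ 2) + ((fun z => (2 * starRingEnd ℂ a * F z).re) + fun z => ‖F z‖ ^ 2) := by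
    ext z
    simp only [Pi.add_apply, ← Complex.normSq_eq_norm_sq, Complex.normSq_apply]
    simp
    ring
  rw [this, Real.circleAverage_add (circleIntegrable_const _ _ _) (hi.add hi'),
    Real.circleAverage_add hi hi', hmean', Real.circleAverage_const, zero_add]

/-- Bessel's inequality for the Taylor coefficients of a holomorphic function. -/
theorem sum_norm_sq_mul_pow_le_circleAverage {R : ℂ → ℂ} {r : ℝ}
    (hR : DifferentiableOn ℂ R (ball 0 1)) (hr : |r| < 1) (n : ℕ) (b : ℕ → ℂ) :
    ∑ k ∈ Finset.range n, ‖b k‖ ^ 2 * (r ^ 2) ^ k ≤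
      Real.circleAverage
        (fun z => ‖∑ k ∈ Finset.range n, b k * z ^ k + z ^ n * R z‖ ^ 2) 0 r := by
  induction n generalizing b with
  | zero =>
    simp only [Finset.range_zero, Finset.sum_empty]
    exact Real.circleAverage_nonneg_of_nonneg fun z _ => by positivity
  | succ n ih =>
    set F : ℂ → ℂ := fun z => ∑ k ∈ Finset.range n, b (k + 1) * z ^ k + z ^ n * R z with hFdef
    have hF : DifferentiableOn ℂ F (ball 0 1) := by
      refine DifferentiableOn.add (Differentiable.differentiableOn (by fun_prop)) ?_
      exact DifferentiableOn.mul (by fun_prop) hR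
    have e : (fun z => ‖∑ k ∈ Finset.range (n + 1), b k * z ^ k + z ^ (n + 1) * R z‖ ^ 2) =
        fun z => ‖b 0 + z * F z‖ ^ 2 := by
      ext z
      rw [Finset.sum_range_succ', hFdef]
      simp only [mul_add, Finset.mul_sum]
      congr 2
      have : ∑ k ∈ Finset.range n, b (k + 1) * z ^ (k + 1) =
        ∑ k ∈ Finset.range n, z * (b (k + 1) * z ^ k) :=
        Finset.sum_congr rfl fun k _ => by ring
      rw [this]
      ring
    rw [e, circleAverage_norm_sq_const_add (F := fun z => z * F z) (differentiableOn_id.mul hF)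
      (by simp) hr]
    have e2 : Real.circleAverage (fun z => ‖z * F z‖ ^ 2) 0 r =
        r ^ 2 * Real.circleAverage (fun z => ‖F z‖ ^ 2) 0 r := by
      rw [← smul_eq_mul, ← Real.circleAverage_fun_smul]
      refine Real.circleAverage_congr_sphere fun z hz => ?_
      have hz' : ‖z‖ = |r| := by simpa using hz
      simp only [norm_mul, mul_pow, hz', sq_abs, smul_eq_mul]
    have hle := mul_le_mul_of_nonneg_left (ih fun k => b (k + 1)) (sq_nonneg r)
    rw [e2, Finset.sum_range_succ', Finset.mul_sum] at *
    have : ∑ k ∈ Finset.range n, ‖b (k + 1)‖ ^ 2 * (r ^ 2) ^ (k + 1) =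
        ∑ k ∈ Finset.range n, r ^ 2 * (‖b (k + 1)‖ ^ 2 * (r ^ 2) ^ k) :=
      Finset.sum_congr rfl fun k _ => by ring
    rw [this]
    simp only [pow_zero, mul_one]
    linarith

/-- Littlewood's subordination principle in quadratic mean, for polynomials. -/
theorem circleAverage_norm_sq_polynomial_comp_le {w : ℂ → ℂ} {r : ℝ}
    (hw : DifferentiableOn ℂ w (ball 0 1)) (hw0 : w 0 = 0) (hw1 : ∀ z ∈ ball (0 : ℂ) 1, ‖w z‖ ≤ 1)
    (hr : |r| < 1) (n : ℕ) (c : ℕ → ℂ) :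
    Real.circleAverage (fun z => ‖∑ k ∈ Finset.range n, c k * w z ^ k‖ ^ 2) 0 r ≤
      ∑ k ∈ Finset.range n, ‖c k‖ ^ 2 := by
  induction n generalizing c with
  | zero => simp [Real.circleAverage_const]
  | succ n ih =>
    set F : ℂ → ℂ := fun z => ∑ k ∈ Finset.range n, c (k + 1) * w z ^ k with hFdef
    have hF : DifferentiableOn ℂ F (ball 0 1) := by
      refine DifferentiableOn.fun_sum fun k _ => ?_
      exact (hw.pow k).const_mul _
    have e : (fun z => ‖∑ k ∈ Finset.range (n + 1), c k * w z ^ k‖ ^ 2) =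
        fun z => ‖c 0 + w z * F z‖ ^ 2 := by
      ext z
      rw [Finset.sum_range_succ', hFdef, Finset.mul_sum, add_comm]
      simp only [pow_zero, mul_one]
      congr 3
      exact Finset.sum_congr rfl fun k _ => by ring
    rw [e, circleAverage_norm_sq_const_add (F := fun z => w z * F z) (hw.mul hF) (by simp [hw0]) hr,
      Finset.sum_range_succ', add_comm]
    gcongr
    refine le_trans (Real.circleAverage_mono ?_ ?_ fun z hz => ?_) (ih fun k => c (k + 1))
    · exact circleIntegrable_of_continuousOn_ball ((hw.mul hF).continuousOn.norm.pow 2) hr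
    · exact circleIntegrable_of_continuousOn_ball (hF.continuousOn.norm.pow 2) hr
    · have hz' : z ∈ ball (0 : ℂ) 1 := closedBall_subset_ball hr (sphere_subset_closedBall hz)
      rw [norm_mul]
      gcongr
      exact mul_le_of_le_one_left (norm_nonneg _) (hw1 z hz')

/-- Rogosinski's theorem on the coefficients of subordinate functions, in its truncated form. -/
theorem sum_norm_sq_le_of_subordinate {w g R h : ℂ → ℂ} {b c : ℕ → ℂ} {n : ℕ}
    (hw : DifferentiableOn ℂ w (ball 0 1)) (hw0 : w 0 = 0) (hw1 : ∀ z ∈ ball (0 : ℂ) 1, ‖w z‖ < 1)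
    (hR : DifferentiableOn ℂ R (ball 0 1))
    (hg : ∀ z ∈ ball (0 : ℂ) 1, g z = ∑ k ∈ Finset.range n, b k * z ^ k + z ^ n * R z)
    (hh : ∀ z ∈ ball (0 : ℂ) 1, HasSum (fun k => c k * z ^ k) (h z))
    (hgh : ∀ z ∈ ball (0 : ℂ) 1, g z = h (w z)) :
    ∑ k ∈ Finset.range n, ‖b k‖ ^ 2 ≤ ∑ k ∈ Finset.range n, ‖c k‖ ^ 2 := by
  obtain ⟨T, hT, hhT⟩ := exists_differentiableOn_eq_sum_add_pow_mul hh n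
  have hmaps : Set.MapsTo w (ball 0 1) (ball 0 1) := fun z hz => by simpa using hw1 z hz
  have hv : DifferentiableOn ℂ (dslope w 0) (ball 0 1) :=
    (differentiableOn_dslope (isOpen_ball.mem_nhds (mem_ball_self one_pos))).2 hw
  have hwv : ∀ z, w z = z * dslope w 0 z := fun z => by
    simpa [hw0] using (sub_smul_dslope w 0 z).symm
  have hS : DifferentiableOn ℂ (fun z => R z - dslope w 0 z ^ n * T (w z)) (ball 0 1) :=
    hR.sub ((hv.pow n).mul (hT.comp hw hmaps))
  have key : ∀ r : ℝ, |r| < 1 →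
      ∑ k ∈ Finset.range n, ‖b k‖ ^ 2 * (r ^ 2) ^ k ≤ ∑ k ∈ Finset.range n, ‖c k‖ ^ 2 := by
    intro r hr
    refine (sum_norm_sq_mul_pow_le_circleAverage hS hr n b).trans ?_
    refine le_of_eq_of_le (Real.circleAverage_congr_sphere fun z hz => ?_)
      (circleAverage_norm_sq_polynomial_comp_le hw hw0 (fun z hz => (hw1 z hz).le) hr n c)
    have hz' : z ∈ ball (0 : ℂ) 1 := closedBall_subset_ball hr (sphere_subset_closedBall hz)
    have h1 := hg z hz'
    rw [hgh z hz', hhT _ (hmaps hz')] at h1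
    have h2 : w z ^ n = z ^ n * dslope w 0 z ^ n := by rw [← mul_pow, ← hwv z]
    congr 2
    rw [h2] at h1
    linear_combination -h1
  have hcont : Continuous fun r : ℝ => ∑ k ∈ Finset.range n, ‖b k‖ ^ 2 * (r ^ 2) ^ k := by
    fun_prop
  have hlim := (hcont.tendsto 1).mono_left (nhdsWithin_le_nhds (s := Set.Iio 1))
  refine le_of_tendsto (by simpa using hlim) ?_
  filter_upwards [Ioo_mem_nhdsLT (show (0 : ℝ) < 1 by norm_num)] with r hr
  exact key r (by rw [abs_of_pos hr.1]; exact hr.2)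

theorem sum_mul_le_sum_mul_of_antitone {d x y : ℕ → ℝ} (hd : Antitone d) (hd0 : ∀ k, 0 ≤ d k)
    (hxy : ∀ n, ∑ k ∈ Finset.range n, x k ≤ ∑ k ∈ Finset.range n, y k) (n : ℕ) :
    ∑ k ∈ Finset.range n, d k * x k ≤ ∑ k ∈ Finset.range n, d k * y k := by
  have key : ∀ n, d n * (∑ k ∈ Finset.range n, y k - ∑ k ∈ Finset.range n, x k) ≤
      ∑ k ∈ Finset.range n, d k * y k - ∑ k ∈ Finset.range n, d k * x k := by
    intro n
    induction n with
    | zero => simp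
    | succ n ih =>
      have h1 := mul_le_mul_of_nonneg_right (hd n.le_succ) (sub_nonneg.2 (hxy (n + 1)))
      simp only [Finset.sum_range_succ] at h1 ⊢
      linarith
  exact sub_nonneg.1 ((mul_nonneg (hd0 n) (sub_nonneg.2 (hxy n))).trans (key n))

/-- `exp` maps the strip `φ - π < Im s < φ` into the half plane of the points nearer to `1` than to
`exp (2 * φ * I)`. -/
theorem norm_exp_sub_one_lt_norm_exp_sub_exp {φ : ℝ} (h0 : 0 < φ) (hπ : φ < Real.pi) {s : ℂ}
    (h1 : φ - Real.pi < s.im) (h2 : s.im < φ) :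
    ‖exp s - 1‖ < ‖exp s - exp (2 * φ * I)‖ := by
  have hsin : 0 < Real.sin (φ - s.im) * Real.sin φ :=
    mul_pos (Real.sin_pos_of_pos_of_lt_pi (by linarith) (by linarith))
      (Real.sin_pos_of_pos_of_lt_pi h0 hπ)
  have hcos : Real.cos s.im - Real.cos (s.im - 2 * φ) =
      2 * (Real.sin (φ - s.im) * Real.sin φ) := by
    rw [Real.cos_sub_cos, show (s.im + (s.im - 2 * φ)) / 2 = -(φ - s.im) by ring,
      show (s.im - (s.im - 2 * φ)) / 2 = φ by ring, Real.sin_neg]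
    ring
  rw [← sq_lt_sq₀ (norm_nonneg _) (norm_nonneg _), ← normSq_eq_norm_sq, ← normSq_eq_norm_sq,
    normSq_apply, normSq_apply]
  have e1 : (exp (2 * φ * I)).re = Real.cos (2 * φ) := by
    simp [exp_re]
  have e2 : (exp (2 * φ * I)).im = Real.sin (2 * φ) := by
    simp [exp_im]
  simp only [sub_re, sub_im, e1, e2, one_re, one_im, exp_re, exp_im]
  rw [Real.cos_sub] at hcos
  have hρ := Real.exp_pos s.re
  have := mul_pos hρ hsin
  nlinarith [Real.sin_sq_add_cos_sq (2 * φ)]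

theorem log_one_sub_sub_log_one_sub {e s w : ℂ} (he : ‖e‖ = 1) (hs : ‖exp s - 1‖ < ‖exp s - e‖)
    (h1 : -Real.pi < s.im) (h2 : s.im < Real.pi) (hw : w = (exp s - 1) / (exp s - e)) :
    log (1 - e * w) - log (1 - w) = s := by
  have hden : exp s - e ≠ 0 := norm_pos_iff.1 ((norm_nonneg _).trans_lt hs)
  have hw1 : ‖w‖ < 1 := by
    rw [hw, norm_div, div_lt_one (norm_pos_iff.2 hden)]
    exact hs
  have hre : ∀ v : ℂ, ‖v‖ < 1 → 0 < (1 - v).re := fun v hv => by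
    simpa using (re_le_norm v).trans_lt hv
  have harg : ∀ v : ℂ, ‖v‖ < 1 → |(log (1 - v)).im| < Real.pi / 2 := fun v hv => by
    rw [log_im]
    exact abs_arg_lt_pi_div_two_iff.2 (Or.inl (hre v hv))
  have hne : ∀ v : ℂ, ‖v‖ < 1 → 1 - v ≠ 0 := fun v hv h => by
    have := hre v hv
    simp [h] at this
  have hew : ‖e * w‖ < 1 := by rwa [norm_mul, he, one_mul]
  have a1 := abs_lt.1 (harg _ hw1)
  have a2 := abs_lt.1 (harg _ hew)
  refine exp_inj_of_neg_pi_lt_of_le_pi ?_ ?_ h1 h2.le ?_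
  · rw [sub_im]; linarith
  · rw [sub_im]; linarith
  · rw [exp_sub, exp_log (hne _ hew), exp_log (hne _ hw1), div_eq_iff (hne _ hw1), hw]
    field_simp
    ring

/-- The Taylor coefficients of `i (L / π) log ((1 - e z) / (1 - z))`, which maps the unit disc onto
a vertical strip of width `L` when `‖e‖ = 1`, `e ≠ 1`. -/
noncomputable def stripCoeff (L : ℝ) (e : ℂ) (k : ℕ) : ℂ := I * L / Real.pi * ((1 - e ^ k) / k)

theorem hasSum_stripCoeff (L : ℝ) {e z : ℂ} (he : ‖e‖ = 1) (hz : z ∈ ball (0 : ℂ) 1) :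
    HasSum (fun k => stripCoeff L e k * z ^ k)
      (I * L / Real.pi * (log (1 - e * z) - log (1 - z))) := by
  have hz1 := mem_ball_zero_iff.1 hz
  have h := ((hasSum_taylorSeries_neg_log hz1).sub
    (hasSum_taylorSeries_neg_log (z := e * z) (by rwa [norm_mul, he, one_mul]))).mul_left
    (I * L / Real.pi)
  rw [show log (1 - e * z) - log (1 - z) = -log (1 - z) - -log (1 - e * z) by ring]
  refine h.congr_fun fun k => ?_
  rw [stripCoeff]
  ring

/-- A holomorphic function with values in a strip is subordinate to the strip mapping. -/
theorem exists_subordination_strip {α β : ℝ} (hα : α < 1) (hβ : 1 < β) {p : ℂ → ℂ}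
    (hp : DifferentiableOn ℂ p (ball 0 1)) (hp0 : p 0 = 0)
    (hps : ∀ z ∈ ball (0 : ℂ) 1, α - 1 < (p z).re ∧ (p z).re < β - 1) {e : ℂ}
    (he : e = exp (2 * Real.pi * I * (1 - (α : ℂ)) / ((β : ℂ) - α))) :
    ∃ w : ℂ → ℂ, DifferentiableOn ℂ w (ball 0 1) ∧ w 0 = 0 ∧ (∀ z ∈ ball (0 : ℂ) 1, ‖w z‖ < 1) ∧
      ∀ z ∈ ball (0 : ℂ) 1,
        p z = I * (β - α : ℝ) / Real.pi * (log (1 - e * w z) - log (1 - w z)) := by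
  have hL : 0 < β - α := by linarith
  have hLc : (β : ℂ) - α ≠ 0 := by exact_mod_cast hL.ne'
  have hπ := Real.pi_pos
  have hπc : (Real.pi : ℂ) ≠ 0 := by exact_mod_cast hπ.ne'
  set φ : ℝ := Real.pi * (1 - α) / (β - α) with hφ
  have hφ0 : 0 < φ := div_pos (mul_pos hπ (by linarith)) hL
  have hφπ : φ < Real.pi := by
    rw [hφ, div_lt_iff₀ hL]
    exact mul_lt_mul_of_pos_left (by linarith) hπ
  have heφ : e = exp (2 * φ * I) := by
    rw [he, hφ]
    congr 1
    push_cast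
    ring
  have he1 : ‖e‖ = 1 := by
    rw [heφ]
    exact_mod_cast norm_exp_ofReal_mul_I (2 * φ)
  set s : ℂ → ℂ := fun z => -I * Real.pi / (β - α) * p z with hs
  have hsd : DifferentiableOn ℂ s (ball 0 1) := hp.const_mul _
  have hsim : ∀ z, (s z).im = -(Real.pi / (β - α) * (p z).re) := fun z => by
    have : s z = ((Real.pi / (β - α) : ℝ) : ℂ) * (-I * p z) := by
      simp only [hs]
      push_cast
      ring
    rw [this, im_ofReal_mul]
    simp
  have hc : 0 < Real.pi / (β - α) := div_pos hπ hL
  have hs1 : ∀ z ∈ ball (0 : ℂ) 1, φ - Real.pi < (s z).im := fun z hz => by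
    have := mul_lt_mul_of_pos_left (hps z hz).2 hc
    have e : Real.pi / (β - α) * (β - 1) = Real.pi - φ := by
      rw [hφ]
      field_simp
      ring
    rw [hsim]
    linarith
  have hs2 : ∀ z ∈ ball (0 : ℂ) 1, (s z).im < φ := fun z hz => by
    have := mul_lt_mul_of_pos_left (hps z hz).1 hc
    have e : Real.pi / (β - α) * (α - 1) = -φ := by
      rw [hφ]
      field_simp
      ring
    rw [hsim]
    linarith
  have hlt : ∀ z ∈ ball (0 : ℂ) 1, ‖exp (s z) - 1‖ < ‖exp (s z) - e‖ := fun z hz => by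
    rw [heφ]
    exact norm_exp_sub_one_lt_norm_exp_sub_exp hφ0 hφπ (hs1 z hz) (hs2 z hz)
  have hden : ∀ z ∈ ball (0 : ℂ) 1, exp (s z) - e ≠ 0 := fun z hz =>
    norm_pos_iff.1 ((norm_nonneg _).trans_lt (hlt z hz))
  refine ⟨fun z => (exp (s z) - 1) / (exp (s z) - e),
    (hsd.cexp.sub_const 1).div (hsd.cexp.sub_const e) hden, by simp [hs, hp0], fun z hz => ?_,
    fun z hz => ?_⟩
  · rw [norm_div, div_lt_one (norm_pos_iff.2 (hden z hz))]
    exact hlt z hz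
  · rw [log_one_sub_sub_log_one_sub he1 (hlt z hz) (by linarith [hs1 z hz])
      (by linarith [hs2 z hz]) rfl]
    simp only [hs]
    push_cast
    field_simp
    linear_combination p z * I_sq

theorem norm_one_sub_sq_of_norm_eq_one {x : ℂ} (hx : ‖x‖ = 1) :
    ((‖1 - x‖ ^ 2 : ℝ) : ℂ) = 2 - x⁻¹ - x := by
  have hx0 : x ≠ 0 := by rintro rfl; simp at hx
  rw [inv_eq_conj hx, ← normSq_eq_norm_sq, normSq_eq_conj_mul_self, map_sub, map_one]
  have : (starRingEnd ℂ) x * x = 1 := by rw [← inv_eq_conj hx, inv_mul_cancel₀ hx0]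
  linear_combination this

theorem hasSum_Li4 {z : ℂ} (hz : ‖z‖ = 1) :
    HasSum (fun k : ℕ => z ^ (k + 1) / ((k : ℂ) + 1) ^ 4) (Li4 z) := by
  refine Summable.hasSum (Summable.of_norm ?_)
  refine ((summable_nat_add_iff 1).2 hasSum_zeta_four.summable).congr fun k => ?_
  rw [norm_div, norm_pow, hz, one_pow, norm_pow]
  have : ‖(k : ℂ) + 1‖ = (k : ℝ) + 1 := by exact_mod_cast norm_natCast (k + 1)
  rw [this]
  push_cast
  rfl

theorem hasSum_norm_stripCoeff_sq (L : ℝ) {e : ℂ} (he : ‖e‖ = 1) :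
    HasSum (fun k : ℕ => ‖stripCoeff L e (k + 1)‖ ^ 2 / (4 * ((k : ℝ) + 1) ^ 2))
      ((L : ℂ) ^ 2 / (4 * (Real.pi : ℂ) ^ 2) *
        ((Real.pi : ℂ) ^ 4 / 45 - Li4 e⁻¹ - Li4 e)).re := by
  have hζ : HasSum (fun k : ℕ => (1 : ℂ) / ((k : ℂ) + 1) ^ 4) ((Real.pi : ℂ) ^ 4 / 90) := by
    have h := (hasSum_nat_add_iff' 1).2 hasSum_zeta_four
    simp only [Finset.range_one, Finset.sum_singleton] at h
    have h' := hasSum_ofReal.2 h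
    norm_num at h' ⊢
    exact h'
  have h := (((hζ.mul_left 2).sub (hasSum_Li4 (by rw [norm_inv, he, inv_one]))).sub
    (hasSum_Li4 he)).mul_left ((L : ℂ) ^ 2 / (4 * (Real.pi : ℂ) ^ 2))
  rw [show (2 : ℂ) * ((Real.pi : ℂ) ^ 4 / 90) = (Real.pi : ℂ) ^ 4 / 45 by ring] at h
  refine (hasSum_re h).congr_fun fun k => ?_
  have hx : ‖e ^ (k + 1)‖ = 1 := by rw [norm_pow, he, one_pow]
  have hk : (k : ℂ) + 1 ≠ 0 := by exact_mod_cast k.succ_ne_zero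
  have hπc : (Real.pi : ℂ) ≠ 0 := by exact_mod_cast Real.pi_ne_zero
  rw [← ofReal_re (‖stripCoeff L e (k + 1)‖ ^ 2 / (4 * ((k : ℝ) + 1) ^ 2))]
  congr 1
  have hn : ‖stripCoeff L e (k + 1)‖ ^ 2 =
      L ^ 2 / Real.pi ^ 2 * (‖1 - e ^ (k + 1)‖ ^ 2 / ((k : ℝ) + 1) ^ 2) := by
    have : ‖((k + 1 : ℕ) : ℂ)‖ = (k : ℝ) + 1 := by simpa using norm_natCast (k + 1)
    rw [stripCoeff, norm_mul, norm_div, norm_div, norm_mul, this]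
    simp [mul_pow, div_pow]
  rw [hn, ofReal_div, ofReal_mul, ofReal_div (‖1 - e ^ (k + 1)‖ ^ 2),
    norm_one_sub_sq_of_norm_eq_one hx, inv_pow]
  push_cast
  have hxe : e ^ (k + 1) ≠ 0 := by
    intro h0
    simp [h0] at hx
  field_simp

/-- Differentiating a truncated power series expansion and multiplying by `z`. -/
theorem mul_deriv_eq_sum_add_pow_mul {g R : ℂ → ℂ} {a : ℕ → ℂ} {n : ℕ}
    (hR : DifferentiableOn ℂ R (ball 0 1))
    (hg : ∀ z ∈ ball (0 : ℂ) 1, g z = ∑ k ∈ Finset.range n, a k * z ^ k + z ^ n * R z) :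
    ∀ z ∈ ball (0 : ℂ) 1, z * deriv g z =
      ∑ k ∈ Finset.range n, (k * a k) * z ^ k + z ^ n * (n * R z + z * deriv R z) := by
  have hpow : ∀ (k : ℕ) (z : ℂ), z * (k * z ^ (k - 1)) = k * z ^ k := fun k z => by
    cases k with
    | zero => simp
    | succ k => simp only [Nat.add_sub_cancel]; ring
  intro z hz
  have hnhds := isOpen_ball.mem_nhds hz
  have hd : HasDerivAt (fun z => ∑ k ∈ Finset.range n, a k * z ^ k + z ^ n * R z)
      (∑ k ∈ Finset.range n, a k * (k * z ^ (k - 1)) +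
        (n * z ^ (n - 1) * R z + z ^ n * deriv R z)) z :=
    (HasDerivAt.fun_sum fun k _ => (hasDerivAt_pow k z).const_mul (a k)).add
      ((hasDerivAt_pow n z).mul (hR.differentiableAt hnhds).hasDerivAt)
  have heq : g =ᶠ[nhds z] fun z => ∑ k ∈ Finset.range n, a k * z ^ k + z ^ n * R z := by
    filter_upwards [hnhds] with x hx using hg x hx
  rw [(hd.congr_of_eventuallyEq heq).deriv, mul_add, Finset.mul_sum]
  have : ∑ k ∈ Finset.range n, z * (a k * (k * z ^ (k - 1))) =
      ∑ k ∈ Finset.range n, (k * a k) * z ^ k :=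
    Finset.sum_congr rfl fun k _ => by linear_combination a k * hpow k z
  rw [this]
  linear_combination R z * hpow n z

/-- Weighted sums of the coefficients of a function `g` for which `z g'` takes values in a strip. -/
theorem sum_norm_sq_le_sum_stripCoeff {α β : ℝ} (hα : α < 1) (hβ : 1 < β) {g : ℂ → ℂ} {a : ℕ → ℂ}
    (hg : ∀ z ∈ ball (0 : ℂ) 1, HasSum (fun k => a k * z ^ k) (g z))
    (hgs : ∀ z ∈ ball (0 : ℂ) 1, α - 1 < (z * deriv g z).re ∧ (z * deriv g z).re < β - 1) {e : ℂ}
    (he : e = exp (2 * Real.pi * I * (1 - (α : ℂ)) / ((β : ℂ) - α))) (he1 : ‖e‖ = 1) (n : ℕ) :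
    ∑ k ∈ Finset.range n, ‖a (k + 1)‖ ^ 2 ≤
      ∑ k ∈ Finset.range n, ‖stripCoeff (β - α) e (k + 1)‖ ^ 2 / ((k : ℝ) + 1) ^ 2 := by
  have hgd : DifferentiableOn ℂ g (ball 0 1) :=
    (differentiableOn_tsum_mul_pow fun z hz => (hg z hz).summable).congr
      fun z hz => (hg z hz).tsum_eq.symm
  obtain ⟨w, hw, hw0, hw1, hpw⟩ := exists_subordination_strip hα hβ
    (p := fun z => z * deriv g z) (differentiableOn_id.mul (hgd.deriv isOpen_ball))
    (by simp) hgs he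
  have hrog : ∀ m, ∑ k ∈ Finset.range m, ‖((k + 1 : ℕ) : ℂ) * a (k + 1)‖ ^ 2 ≤
      ∑ k ∈ Finset.range m, ‖stripCoeff (β - α) e (k + 1)‖ ^ 2 := fun m => by
    obtain ⟨R, hR, hgR⟩ := exists_differentiableOn_eq_sum_add_pow_mul hg (m + 1)
    have := sum_norm_sq_le_of_subordinate hw hw0 hw1
      ((hR.const_mul _).add (differentiableOn_id.mul (hR.deriv isOpen_ball)))
      (mul_deriv_eq_sum_add_pow_mul hR hgR)
      (fun z hz => hasSum_stripCoeff (β - α) he1 hz) hpw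
    rw [Finset.sum_range_succ', Finset.sum_range_succ'] at this
    simpa [stripCoeff] using this
  have hd : Antitone fun k : ℕ => 1 / ((k : ℝ) + 1) ^ 2 := fun i j hij => by
    have : (i : ℝ) ≤ j := by exact_mod_cast hij
    dsimp only
    gcongr
  have h := sum_mul_le_sum_mul_of_antitone hd (fun k => by positivity) hrog n
  refine le_of_eq_of_le (Finset.sum_congr rfl fun k _ => ?_)
    (h.trans_eq (Finset.sum_congr rfl fun k _ => by ring))
  have hk : ‖((k + 1 : ℕ) : ℂ)‖ = (k : ℝ) + 1 := by simpa using norm_natCast (k + 1)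
  have : (k : ℝ) + 1 ≠ 0 := by positivity
  rw [norm_mul, hk]
  field_simp

/-- For `f ∈ S(α,β)`, the logarithmic coefficients satisfy
`Σ |γ_n|² ≤ ((β-α)²/(4π²))(π⁴/45 - Li₄(e^{-2πi(1-α)/(β-α)}) - Li₄(e^{2πi(1-α)/(β-α)}))`. -/
theorem sum_sq_logCoeff_S_alpha_beta (α β : ℝ) (hα : α < 1) (hβ : 1 < β)
    (f : ℂ → ℂ) (hf : DifferentiableOn ℂ f (ball 0 1))
    (hf0 : f 0 = 0) (hf1 : deriv f 0 = 1)
    (hfz : ∀ z ∈ ball (0 : ℂ) 1, z ≠ 0 → f z ≠ 0)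
    (hS : ∀ z ∈ ball (0 : ℂ) 1, z ≠ 0 →
      α < (z * deriv f z / f z).re ∧ (z * deriv f z / f z).re < β)
    (γ : ℕ → ℂ)
    (hγ : ∀ z ∈ ball (0 : ℂ) 1, z ≠ 0 →
      HasSum (fun n : ℕ => 2 * γ (n + 1) * z ^ (n + 1)) (Complex.log (f z / z))) :
    Summable (fun n : ℕ => ‖γ (n + 1)‖ ^ 2) ∧
    ∑' n : ℕ, ‖γ (n + 1)‖ ^ 2 ≤
      (((((β : ℂ) - α) ^ 2) / (4 * (Real.pi : ℂ) ^ 2)) *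
        ((Real.pi : ℂ) ^ 4 / 45 -
          Li4 (Complex.exp (-2 * Real.pi * Complex.I * (1 - (α : ℂ)) / ((β : ℂ) - α))) -
          Li4 (Complex.exp (2 * Real.pi * Complex.I * (1 - (α : ℂ)) / ((β : ℂ) - α))))).re := by
  set e : ℂ := exp (2 * Real.pi * I * (1 - (α : ℂ)) / ((β : ℂ) - α)) with he
  have he1 : ‖e‖ = 1 := by
    rw [he, show (2 * Real.pi * I * (1 - (α : ℂ)) / ((β : ℂ) - α)) =
      ((2 * Real.pi * (1 - α) / (β - α) : ℝ) : ℂ) * I by push_cast; ring]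
    exact norm_exp_ofReal_mul_I _
  have heinv : exp (-2 * Real.pi * I * (1 - (α : ℂ)) / ((β : ℂ) - α)) = e⁻¹ := by
    rw [he, ← exp_neg]
    congr 1
    ring
  set a : ℕ → ℂ := fun k => if k = 0 then 0 else 2 * γ k with ha
  set g : ℂ → ℂ := fun z => if z = 0 then 0 else log (f z / z) with hgdef
  have hg : ∀ z ∈ ball (0 : ℂ) 1, HasSum (fun k => a k * z ^ k) (g z) := fun z hz => by
    rw [← hasSum_nat_add_iff' 1]
    rcases eq_or_ne z 0 with rfl | h0
    · simp [ha, hgdef]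
    · simpa [ha, hgdef, h0] using hγ z hz h0
  have hgd : DifferentiableOn ℂ g (ball 0 1) :=
    (differentiableOn_tsum_mul_pow fun z hz => (hg z hz).summable).congr
      fun z hz => (hg z hz).tsum_eq.symm
  have hfg : ∀ z ∈ ball (0 : ℂ) 1, f z = z * exp (g z) := fun z hz => by
    rcases eq_or_ne z 0 with rfl | h0
    · simp [hf0]
    · simp only [hgdef, h0, if_false]
      rw [exp_log (div_ne_zero (hfz z hz h0) h0), mul_div_cancel₀ _ h0]
  have hgs : ∀ z ∈ ball (0 : ℂ) 1,
      α - 1 < (z * deriv g z).re ∧ (z * deriv g z).re < β - 1 := fun z hz => by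
    rcases eq_or_ne z 0 with rfl | h0
    · simp only [zero_mul, zero_re]
      exact ⟨by linarith, by linarith⟩
    · have hnhds := isOpen_ball.mem_nhds hz
      have hd := (hasDerivAt_id z).mul (hgd.differentiableAt hnhds).hasDerivAt.cexp
      have heq : f =ᶠ[nhds z] fun z => z * exp (g z) := by
        filter_upwards [hnhds] with x hx using hfg x hx
      have hquot : z * deriv f z / f z = 1 + z * deriv g z := by
        rw [(hd.congr_of_eventuallyEq heq).deriv, hfg z hz]
        have := exp_ne_zero (g z)
        simp only [id]
        field_simp
      have := hS z hz h0
      rw [hquot, add_re, one_re] at this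
      exact ⟨by linarith, by linarith⟩
  have hsum := hasSum_norm_stripCoeff_sq (β - α) he1
  rw [heinv]
  push_cast at hsum
  have hle : ∀ n, ∑ k ∈ Finset.range n, ‖γ (k + 1)‖ ^ 2 ≤ _ := fun n => by
    refine le_trans ?_ (sum_le_hasSum (Finset.range n) (fun k _ => by positivity) hsum)
    have h := sum_norm_sq_le_sum_stripCoeff hα hβ hg hgs he he1 n
    have h4 : ∀ k, ‖a (k + 1)‖ ^ 2 = 4 * ‖γ (k + 1)‖ ^ 2 := fun k => by
      simp [ha, mul_pow]
      norm_num
    simp only [h4, ← Finset.mul_sum] at h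
    have e4 : ∑ k ∈ Finset.range n, ‖stripCoeff (β - α) e (k + 1)‖ ^ 2 / (4 * ((k : ℝ) + 1) ^ 2) =
        (∑ k ∈ Finset.range n, ‖stripCoeff (β - α) e (k + 1)‖ ^ 2 / ((k : ℝ) + 1) ^ 2) / 4 := by
      rw [Finset.sum_div]
      exact Finset.sum_congr rfl fun k _ => by rw [div_div, mul_comm]
    rw [e4]
    linarith
  exact ⟨summable_of_sum_range_le (fun k => by positivity) hle,
    Real.tsum_le_of_sum_range_le (fun k => by positivity) hle⟩
end

section
/- If f ∈ S(α,β) with α < 1 < β, then the logarithmic coefficients γ_n of f satisfy |γ_n| ≤ ((β-α)/(nπ)) |sin(π(1-α)/(β-α))| for every n ≥ 1. -/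
open Complex Metric

section PowerSeries

variable {a : ℕ → ℂ}

lemma summable_norm_mul_pow (ha : ∀ z ∈ ball (0 : ℂ) 1, Summable fun m => a m * z ^ m)
    {r : ℝ} (hr0 : 0 ≤ r) (hr : r < 1) : Summable fun m => ‖a m‖ * r ^ m := by
  have h := (ha r (by simpa [abs_of_nonneg hr0] using hr)).norm
  simpa [abs_of_nonneg hr0] using h

lemma differentiableAt_and_hasSum_deriv_tsum_mul_pow
    (ha : ∀ z ∈ ball (0 : ℂ) 1, Summable fun m => a m * z ^ m)
    {z : ℂ} (hz : z ∈ ball (0 : ℂ) 1) :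
    DifferentiableAt ℂ (fun w => ∑' m, a m * w ^ m) z ∧
      HasSum (fun m => a m * (m * z ^ (m - 1))) (deriv (fun w => ∑' m, a m * w ^ m) z) := by
  rw [mem_ball_zero_iff] at hz
  obtain ⟨r, hzr, hr⟩ := exists_between hz
  have hr0 : 0 ≤ r := (norm_nonneg z).trans hzr.le
  have hu := summable_norm_mul_pow ha hr0 hr
  have hd : ∀ m : ℕ, DifferentiableOn ℂ (fun w : ℂ => a m * w ^ m) (ball 0 r) :=
    fun m => by fun_prop
  have hle : ∀ (m : ℕ) (w : ℂ), w ∈ ball (0 : ℂ) r → ‖a m * w ^ m‖ ≤ ‖a m‖ * r ^ m := by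
    intro m w hw
    rw [mem_ball_zero_iff] at hw
    rw [norm_mul, norm_pow]
    gcongr
  have hzU : z ∈ ball (0 : ℂ) r := by simpa using hzr
  refine ⟨(differentiableOn_tsum_of_summable_norm hu hd isOpen_ball hle).differentiableAt
    (isOpen_ball.mem_nhds hzU), ?_⟩
  simpa using hasSum_deriv_of_summable_norm hu hd isOpen_ball hle hzU

lemma deriv_tsum_mul_pow_zero (ha : ∀ z ∈ ball (0 : ℂ) 1, Summable fun m => a m * z ^ m) :
    deriv (fun w => ∑' m, a m * w ^ m) 0 = a 1 := by
  refine (differentiableAt_and_hasSum_deriv_tsum_mul_pow ha (mem_ball_self one_pos)).2.unique ?_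
  convert hasSum_single 1 ?_ using 1
  · simp
  · rintro (_ | _ | m) hm <;> simp at hm ⊢

end PowerSeries

/-- The terms whose index is a multiple of `n` are extracted by averaging over the `n`-th roots
of unity. -/
lemma hasSum_mul_pow_of_isPrimitiveRoot {c : ℕ → ℂ} {q : ℂ → ℂ}
    (hq : ∀ z ∈ ball (0 : ℂ) 1, HasSum (fun m => c m * z ^ m) (q z))
    {n : ℕ} (hn : n ≠ 0) {ω : ℂ} (hω : IsPrimitiveRoot ω n) {z : ℂ} (hz : z ∈ ball (0 : ℂ) 1) :
    HasSum (fun k => c (n * k) * (z ^ n) ^ k)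
      ((n : ℂ)⁻¹ * ∑ j ∈ Finset.range n, q (ω ^ j * z)) := by
  have hnC : (n : ℂ) ≠ 0 := Nat.cast_ne_zero.2 hn
  have h1 : HasSum (fun m => (n : ℂ)⁻¹ * ∑ j ∈ Finset.range n, c m * (ω ^ j * z) ^ m)
      ((n : ℂ)⁻¹ * ∑ j ∈ Finset.range n, q (ω ^ j * z)) := by
    refine (hasSum_sum fun j _ => hq _ ?_).mul_left _
    simpa [hω.norm'_eq_one hn] using hz
  have h2 : ∀ m, ∑ j ∈ Finset.range n, c m * (ω ^ j * z) ^ m =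
      c m * z ^ m * ∑ j ∈ Finset.range n, (ω ^ m) ^ j := by
    intro m
    rw [Finset.mul_sum]
    refine Finset.sum_congr rfl fun j _ => ?_
    rw [mul_pow, ← pow_mul, ← pow_mul, mul_comm j m]
    ring
  have hinj : Function.Injective fun k : ℕ => n * k := fun _ _ h =>
    Nat.eq_of_mul_eq_mul_left (Nat.pos_of_ne_zero hn) h
  rw [← hinj.hasSum_iff] at h1
  · convert h1 using 2 with k
    have : ω ^ (n * k) = 1 := by rw [pow_mul, hω.pow_eq_one, one_pow]
    simp only [Function.comp_apply]
    rw [h2, this]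
    simp only [one_pow, Finset.sum_const, Finset.card_range, nsmul_eq_mul, mul_one, pow_mul]
    field_simp
  · intro m hm
    have hne : ω ^ m ≠ 1 := by
      rw [Ne, hω.pow_eq_one_iff_dvd]
      rintro ⟨k, rfl⟩
      exact hm ⟨k, rfl⟩
    rw [h2, geom_sum_eq hne, ← pow_mul, mul_comm m n, pow_mul, hω.pow_eq_one]
    simp

/-- The Schwarz lemma at the origin for maps of the unit disc into a vertical strip. -/
lemma norm_deriv_le_of_re_mem_Ioo {a b : ℝ} {G : ℂ → ℂ} (hG : DifferentiableOn ℂ G (ball 0 1))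
    (hG0 : G 0 = 0) (hre : ∀ z ∈ ball (0 : ℂ) 1, (G z).re ∈ Set.Ioo a b) :
    ‖deriv G 0‖ ≤ 2 * (b - a) / Real.pi * |Real.sin (Real.pi * a / (b - a))| := by
  have h0 := hre 0 (mem_ball_self one_pos)
  rw [hG0] at h0
  obtain ⟨ha, hb⟩ : a < 0 ∧ 0 < b := h0
  have hL : 0 < b - a := by linarith
  set κ : ℝ := Real.pi / (b - a) with hκ
  have hκ0 : 0 < κ := by positivity
  have hκL : κ * (b - a) = Real.pi := by rw [hκ]; field_simp
  set E : ℂ → ℂ := fun z => exp (I * (κ * (G z - a))) with hE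
  have hEim : ∀ z ∈ ball (0 : ℂ) 1, 0 < (E z).im := by
    intro z hz
    obtain ⟨h1, h2⟩ := hre z hz
    rw [hE, exp_im]
    refine mul_pos (Real.exp_pos _) (Real.sin_pos_of_pos_of_lt_pi ?_ ?_)
    · simp; exact mul_pos hκ0 (by linarith)
    · simp; rw [← hκL]; gcongr
  set e : ℂ := E 0 with he
  have heim : 0 < e.im := hEim 0 (mem_ball_self one_pos)
  have hee : e = exp (((-(κ * a) : ℝ) : ℂ) * I) := by
    rw [he, hE]; simp only [hG0]; push_cast; ring_nf
  have hne : ∀ z ∈ ball (0 : ℂ) 1, E z - (starRingEnd ℂ) e ≠ 0 := by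
    intro z hz h
    have := congrArg Complex.im h
    simp at this
    linarith [hEim z hz]
  have hψmaps : Set.MapsTo (fun z => (E z - e) / (E z - (starRingEnd ℂ) e))
      (ball 0 1) (closedBall 0 1) := by
    intro z hz
    rw [mem_closedBall_zero_iff, norm_div]
    refine div_le_one_of_le₀ ?_ (norm_nonneg _)
    rw [← sq_le_sq₀ (norm_nonneg _) (norm_nonneg _), ← normSq_eq_norm_sq, ← normSq_eq_norm_sq,
      normSq_apply, normSq_apply]
    simp
    nlinarith [mul_pos (hEim z hz) heim]
  have hEd : DifferentiableOn ℂ E (ball 0 1) := by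
    rw [hE]; fun_prop
  have hψd : DifferentiableOn ℂ (fun z => (E z - e) / (E z - (starRingEnd ℂ) e)) (ball 0 1) :=
    (hEd.sub_const _).div (hEd.sub_const _) hne
  have hnhds : ball (0 : ℂ) 1 ∈ nhds 0 := ball_mem_nhds _ one_pos
  have hGd : HasDerivAt G (deriv G 0) 0 := (hG.differentiableAt hnhds).hasDerivAt
  have hEd0 : HasDerivAt E (e * (I * (κ * deriv G 0))) 0 :=
    (((hGd.sub_const _).const_mul _).const_mul _).cexp
  have hψ0 := (hEd0.sub_const e).div (hEd0.sub_const ((starRingEnd ℂ) e))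
    (hne 0 (mem_ball_self one_pos))
  have hsch := norm_deriv_le_div_of_mapsTo_ball (R₂ := 1) hψd
    (by simpa [← he] using hψmaps) one_pos
  have hval : deriv (fun z => (E z - e) / (E z - (starRingEnd ℂ) e)) 0 =
      e * (I * (κ * deriv G 0)) / (e - (starRingEnd ℂ) e) := by
    refine hψ0.deriv.trans ?_
    have := hne 0 (mem_ball_self one_pos)
    rw [← he] at this ⊢
    field_simp
    ring
  have hnorm : ‖e‖ = 1 := by rw [hee, norm_exp_ofReal_mul_I]
  have hconj : ‖e - (starRingEnd ℂ) e‖ = 2 * e.im := by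
    rw [sub_conj]
    simp [abs_of_pos heim]
  have hsin : |Real.sin (Real.pi * a / (b - a))| = e.im := by
    have h : e.im = -Real.sin (Real.pi * a / (b - a)) := by
      rw [hee, exp_ofReal_mul_I_im, Real.sin_neg, hκ]
      ring_nf
    rw [← abs_of_pos heim, h, abs_neg]
  rw [hval, norm_div, norm_mul, norm_mul, norm_mul, hnorm, hconj, norm_I, norm_real,
    Real.norm_of_nonneg hκ0.le, div_one, one_mul, one_mul, div_le_one (by positivity)] at hsch
  have hinv : 2 * (b - a) / Real.pi * e.im = 2 * e.im / κ := by
    rw [hκ]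
    field_simp
  rwa [hsin, hinv, le_div_iff₀ hκ0, mul_comm]

lemma re_inv_mul_sum_mem_Ioo {a b : ℝ} {n : ℕ} (hn : n ≠ 0) {u : ℕ → ℂ}
    (hu : ∀ j, (u j).re ∈ Set.Ioo a b) :
    ((n : ℂ)⁻¹ * ∑ j ∈ Finset.range n, u j).re ∈ Set.Ioo a b := by
  have hn' : (0 : ℝ) < n := by positivity
  have hne : (Finset.range n).Nonempty := Finset.nonempty_range_iff.2 hn
  have h : ((n : ℂ)⁻¹ * ∑ j ∈ Finset.range n, u j).re =
      (∑ j ∈ Finset.range n, (u j).re) / n := by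
    rw [← Complex.ofReal_natCast, ← Complex.ofReal_inv, Complex.re_ofReal_mul, Complex.re_sum]
    field_simp
  have h1 := Finset.sum_lt_sum_of_nonempty hne fun j _ => (hu j).1
  have h2 := Finset.sum_lt_sum_of_nonempty hne fun j _ => (hu j).2
  simp only [Finset.sum_const, Finset.card_range, nsmul_eq_mul] at h1 h2
  rw [h, Set.mem_Ioo, lt_div_iff₀ hn', div_lt_iff₀ hn']
  constructor <;> linarith

/-- Rogosinski's coefficient theorem for functions subordinate to a map onto a vertical strip. -/
lemma norm_coeff_le_of_re_mem_Ioo {a b : ℝ} {c : ℕ → ℂ} {q : ℂ → ℂ} (hc0 : c 0 = 0)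
    (hq : ∀ z ∈ ball (0 : ℂ) 1, HasSum (fun m => c m * z ^ m) (q z))
    (hre : ∀ z ∈ ball (0 : ℂ) 1, (q z).re ∈ Set.Ioo a b) {n : ℕ} (hn : n ≠ 0) :
    ‖c n‖ ≤ 2 * (b - a) / Real.pi * |Real.sin (Real.pi * a / (b - a))| := by
  have hω := Complex.isPrimitiveRoot_exp n hn
  set ω := exp (2 * Real.pi * I / n)
  have hroot : ∀ w ∈ ball (0 : ℂ) 1, ∃ z ∈ ball (0 : ℂ) 1, z ^ n = w := by
    intro w hw
    obtain ⟨z, rfl⟩ := IsAlgClosed.exists_pow_nat_eq w (Nat.pos_of_ne_zero hn)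
    refine ⟨z, ?_, rfl⟩
    rw [mem_ball_zero_iff] at hw ⊢
    rwa [norm_pow, pow_lt_one_iff_of_nonneg (norm_nonneg _) hn] at hw
  have hG : ∀ w ∈ ball (0 : ℂ) 1, ∃ v : ℂ, v.re ∈ Set.Ioo a b ∧
      HasSum (fun k => c (n * k) * w ^ k) v := by
    intro w hw
    obtain ⟨z, hz, rfl⟩ := hroot w hw
    refine ⟨_, re_inv_mul_sum_mem_Ioo hn fun j => hre _ ?_,
      hasSum_mul_pow_of_isPrimitiveRoot hq hn hω hz⟩
    simpa [hω.norm'_eq_one hn] using hz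
  have hsum : ∀ w ∈ ball (0 : ℂ) 1, Summable fun k => c (n * k) * w ^ k := fun w hw =>
    let ⟨_, _, h⟩ := hG w hw
    h.summable
  have key := norm_deriv_le_of_re_mem_Ioo (a := a) (b := b)
    (G := fun w => ∑' k, c (n * k) * w ^ k)
    (fun w hw => (differentiableAt_and_hasSum_deriv_tsum_mul_pow hsum hw).1.differentiableWithinAt)
    (by
      rw [tsum_eq_single 0 (by intro k hk; simp [hk])]
      simp [hc0])
    (fun w hw => by
      obtain ⟨v, hv, h⟩ := hG w hw
      rwa [h.tsum_eq])
  rwa [deriv_tsum_mul_pow_zero (a := fun k => c (n * k)) hsum, mul_one] at key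

/-- For `f ∈ S(α,β)`, `|γ_n| ≤ ((β-α)/(nπ)) |sin(π(1-α)/(β-α))|` for all `n ≥ 1`. -/
theorem logCoeff_bound_S_alpha_beta (α β : ℝ) (hα : α < 1) (hβ : 1 < β)
    (f : ℂ → ℂ) (hf : DifferentiableOn ℂ f (ball 0 1))
    (hf0 : f 0 = 0) (hf1 : deriv f 0 = 1)
    (hfz : ∀ z ∈ ball (0 : ℂ) 1, z ≠ 0 → f z ≠ 0)
    (hS : ∀ z ∈ ball (0 : ℂ) 1, z ≠ 0 →
      α < (z * deriv f z / f z).re ∧ (z * deriv f z / f z).re < β)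
    (γ : ℕ → ℂ)
    (hγ : ∀ z ∈ ball (0 : ℂ) 1, z ≠ 0 →
      HasSum (fun n : ℕ => 2 * γ (n + 1) * z ^ (n + 1)) (Complex.log (f z / z))) :
    ∀ n : ℕ, 1 ≤ n →
      ‖γ n‖ ≤ ((β - α) / (n * Real.pi)) * |Real.sin (Real.pi * (1 - α) / (β - α))| := by
  intro n hn
  obtain ⟨n, rfl⟩ := Nat.exists_eq_succ_of_ne_zero (Nat.one_le_iff_ne_zero.1 hn)
  set l : ℕ → ℂ := fun m => if m = 0 then 0 else 2 * γ m with hl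
  have hlog : ∀ z ∈ ball (0 : ℂ) 1, z ≠ 0 →
      HasSum (fun m => l m * z ^ m) (Complex.log (f z / z)) := by
    intro z hz hz0
    rw [← hasSum_nat_add_iff' 1]
    simpa [hl] using hγ z hz hz0
  have hsum : ∀ z ∈ ball (0 : ℂ) 1, Summable fun m => l m * z ^ m := by
    intro z hz
    rcases eq_or_ne z 0 with rfl | hz0
    · exact (hasSum_single 0 fun m hm => by simp [hm]).summable
    · exact (hlog z hz hz0).summable
  set g : ℂ → ℂ := fun w => ∑' m, l m * w ^ m with hg
  have hq : ∀ z ∈ ball (0 : ℂ) 1, HasSum (fun m => (m * l m) * z ^ m) (z * deriv g z) := by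
    intro z hz
    have hterm : (fun m : ℕ => m * l m * z ^ m) = fun m => z * (l m * (m * z ^ (m - 1))) := by
      funext m
      rcases m with _ | m
      · simp
      · simp [pow_succ]; ring
    rw [hterm]
    exact (differentiableAt_and_hasSum_deriv_tsum_mul_pow hsum hz).2.mul_left z
  have hderiv : ∀ z ∈ ball (0 : ℂ) 1, z ≠ 0 → z * deriv g z = z * deriv f z / f z - 1 := by
    intro z hz hz0
    have hfz0 := hfz z hz hz0
    have hexp : ∀ w ∈ ball (0 : ℂ) 1, w ≠ 0 → exp (g w) * w = f w := by
      intro w hw hw0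
      rw [hg]
      simp only
      rw [(hlog w hw hw0).tsum_eq, Complex.exp_log (div_ne_zero (hfz w hw hw0) hw0),
        div_mul_cancel₀ _ hw0]
    have hgd := (differentiableAt_and_hasSum_deriv_tsum_mul_pow hsum hz).1.hasDerivAt
    have hprod := hgd.cexp.mul (hasDerivAt_id z)
    have hev : f =ᶠ[nhds z] fun w => exp (g w) * w := by
      filter_upwards [isOpen_ball.mem_nhds hz, isOpen_ne.mem_nhds hz0] with w hw hw0
      exact (hexp w hw hw0).symm
    have hfd : deriv f z = exp (g z) * deriv g z * z + exp (g z) * 1 :=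
      (hprod.congr_of_eventuallyEq hev).deriv
    rw [hfd, ← hexp z hz hz0]
    have := Complex.exp_ne_zero (g z)
    field_simp
    ring
  have hre : ∀ z ∈ ball (0 : ℂ) 1, (z * deriv g z).re ∈ Set.Ioo (α - 1) (β - 1) := by
    intro z hz
    rcases eq_or_ne z 0 with rfl | hz0
    · simp [hα, hβ]
    · rw [hderiv z hz hz0]
      obtain ⟨h1, h2⟩ := hS z hz hz0
      simp only [sub_re, one_re, Set.mem_Ioo]
      constructor <;> linarith
  have key := norm_coeff_le_of_re_mem_Ioo (c := fun m => m * l m) (by simp) hq hre n.succ_ne_zero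
  have hsin : |Real.sin (Real.pi * (α - 1) / (β - 1 - (α - 1)))| =
      |Real.sin (Real.pi * (1 - α) / (β - α))| := by
    rw [← abs_neg, ← Real.sin_neg]
    congr 2
    ring
  rw [hsin] at key
  have hN : (0 : ℝ) < (n.succ : ℕ) := by positivity
  simp only [hl, Nat.succ_ne_zero, if_false, norm_mul, Complex.norm_natCast,
    Complex.norm_ofNat] at key
  have heq : (β - α) / ((n.succ : ℕ) * Real.pi) * |Real.sin (Real.pi * (1 - α) / (β - α))| =
      (2 * (β - 1 - (α - 1)) / Real.pi * |Real.sin (Real.pi * (1 - α) / (β - α))|) /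
        (2 * (n.succ : ℕ)) := by
    have := Real.pi_pos
    field_simp
    ring
  rw [heq, le_div_iff₀ (by positivity)]
  linarith
end

section
/- For 0 ≤ α < 1 and β > 1, the bound ((β-α)/(nπ)) |sin(π(1-α)/(β-α))| ≤ (1-α)/n holds for every n ≥ 1. Consequently, for f starlike of order α (i.e. Re(zf'(z)/f(z)) > α on the unit disc), the logarithmic coefficients satisfy |γ_n| ≤ (1-α)/n. -/
open Complex Metric

/-- A complex power series converging to `G` on the open unit disc is its power series there. -/
theorem hasFPowerSeriesOnBall_ofScalars_of_hasSum {G : ℂ → ℂ} {c : ℕ → ℂ}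
    (hG : ∀ z ∈ ball (0 : ℂ) 1, HasSum (fun n : ℕ => c n * z ^ n) (G z)) :
    HasFPowerSeriesOnBall G (FormalMultilinearSeries.ofScalars ℂ c) 0 1 where
  r_le := by
    refine ENNReal.le_of_forall_nnreal_lt fun r hr => ?_
    have hr1 : (r : ℝ) < 1 := by exact_mod_cast hr
    have hz : ((r : ℝ) : ℂ) ∈ ball (0 : ℂ) 1 := by simpa using hr1
    refine FormalMultilinearSeries.le_radius_of_tendsto (l := 0) _ ?_
    have h := (hG _ hz).summable.tendsto_atTop_zero.norm
    simpa [FormalMultilinearSeries.ofScalars_norm] using h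
  r_pos := one_pos
  hasSum := fun {y} hy => by
    have hy' : y ∈ ball (0 : ℂ) 1 := by
      rwa [← ENNReal.ofReal_one, eball_ofReal] at hy
    simpa [FormalMultilinearSeries.ofScalars_apply_eq, mul_comm] using hG y hy'

/-- The Cauchy formula for the Taylor coefficients, as a circle average. -/
theorem circleAverage_inv_pow_mul_of_hasFPowerSeriesAt {G : ℂ → ℂ}
    {P : FormalMultilinearSeries ℂ ℂ ℂ} {r : ℝ} (hr : 0 < r)
    (hG : DifferentiableOn ℂ G (closedBall 0 r)) (hP : HasFPowerSeriesAt G P 0) (n : ℕ) :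
    Real.circleAverage (fun z => (z ^ n)⁻¹ * G z) 0 r = P.coeff n := by
  lift r to NNReal using hr.le
  have h := (hG.hasFPowerSeriesOnBall (by exact_mod_cast hr)).hasFPowerSeriesAt
  rw [hP.eq_formalMultilinearSeries h, FormalMultilinearSeries.coeff,
    Real.circleAverage_eq_circleIntegral hr.ne']
  simp only [cauchyPowerSeries, ContinuousMultilinearMap.mkPiRing_apply, Pi.one_apply,
    Finset.prod_const_one, sub_zero, smul_eq_mul, one_mul]
  congr 2
  funext z
  rw [inv_pow]
  ring

/-- Multiplication of the `n`-th Taylor coefficient by `n` under the operator taking `G` to `z * deriv G z`. -/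
theorem circleAverage_inv_pow_mul_id_mul_deriv {G : ℂ → ℂ} {r : ℝ} (hr : 0 < r)
    (hG : ∀ z ∈ closedBall (0 : ℂ) r, AnalyticAt ℂ G z) (n : ℕ) :
    Real.circleAverage (fun z => (z ^ n)⁻¹ * (z * deriv G z)) 0 r =
      n * Real.circleAverage (fun z => (z ^ n)⁻¹ * G z) 0 r := by
  have hne : ∀ z ∈ sphere (0 : ℂ) r, z ≠ 0 := fun z hz => ne_of_mem_sphere hz hr.ne'
  have hcG : ContinuousOn G (sphere 0 r) := fun z hz =>
    (hG z (sphere_subset_closedBall hz)).continuousAt.continuousWithinAt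
  have hcG' : ContinuousOn (deriv G) (sphere 0 r) := fun z hz =>
    (hG z (sphere_subset_closedBall hz)).deriv.continuousAt.continuousWithinAt
  have hpow : ContinuousOn (fun z : ℂ => (z ^ n)⁻¹) (sphere 0 r) :=
    (continuousOn_id.pow n).inv₀ fun z hz => pow_ne_zero _ (hne z hz)
  have h1 : CircleIntegrable (fun z => (z ^ n)⁻¹ * (z * deriv G z)) 0 r :=
    (hpow.mul (continuousOn_id.mul hcG')).circleIntegrable hr.le
  have h2 : CircleIntegrable (fun z => (n : ℂ) • ((z ^ n)⁻¹ * G z)) 0 r :=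
    ((hpow.mul hcG).const_smul (n : ℂ)).circleIntegrable hr.le
  rw [← smul_eq_mul (n : ℂ), ← Real.circleAverage_fun_smul, ← sub_eq_zero,
    ← Real.circleAverage_fun_sub h1 h2, Real.circleAverage_eq_circleIntegral hr.ne']
  refine smul_eq_zero_of_right _
    (circleIntegral.integral_eq_zero_of_hasDerivWithinAt (f := fun z => (z ^ n)⁻¹ * G z) hr.le
      fun z hz => ?_)
  have hz0 := hne z hz
  have hd := (((hasDerivAt_pow n z).inv (pow_ne_zero n hz0)).mul
    (hG z (sphere_subset_closedBall hz)).differentiableAt.hasDerivAt).hasDerivWithinAt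
    (s := sphere 0 r)
  refine hd.congr_deriv ?_
  rcases n with _ | n
  · simp [hz0]
  · simp only [sub_zero, smul_eq_mul, Nat.add_sub_cancel, Pi.inv_apply]
    field_simp
    ring

/-- The **Carathéodory coefficient inequality** on a circle: a holomorphic function with nonnegative
real part has Taylor coefficients bounded by twice the real part of its value at the centre. -/
theorem norm_circleAverage_inv_pow_mul_le {h : ℂ → ℂ} {r : ℝ} (hr : 0 < r)
    (hh : DifferentiableOn ℂ h (closedBall 0 r)) (hre : ∀ z ∈ closedBall (0 : ℂ) r, 0 ≤ (h z).re)
    {n : ℕ} (hn : n ≠ 0) :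
    ‖Real.circleAverage (fun z => (z ^ n)⁻¹ * h z) 0 r‖ * r ^ n ≤ 2 * (h 0).re := by
  have hdc : ∀ g : ℂ → ℂ, DifferentiableOn ℂ g (closedBall 0 r) →
      Real.circleAverage g 0 r = g 0 := fun g hg =>
    DiffContOnCl.circleAverage (by
      rw [abs_of_pos hr]
      exact (hg.mono closure_ball_subset_closedBall).diffContOnCl)
  have hne : ∀ z ∈ sphere (0 : ℂ) r, z ≠ 0 := fun z hz => ne_of_mem_sphere hz hr.ne'
  have hch : ContinuousOn h (sphere 0 r) := hh.continuousOn.mono sphere_subset_closedBall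
  have hpow : ContinuousOn (fun z : ℂ => (z ^ n)⁻¹) (sphere 0 r) :=
    (continuousOn_id.pow n).inv₀ fun z hz => pow_ne_zero _ (hne z hz)
  have hint : CircleIntegrable h 0 r := hch.circleIntegrable hr.le
  have hint1 : CircleIntegrable (fun z => (z ^ n)⁻¹ * h z) 0 r :=
    (hpow.mul hch).circleIntegrable hr.le
  have hint2 : CircleIntegrable (fun z => z ^ n * h z) 0 r :=
    ((continuousOn_id.pow n).mul hch).circleIntegrable hr.le
  have hre_avg : Real.circleAverage (fun z => (h z).re) 0 r = (h 0).re := by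
    rw [← hdc h hh]
    exact reCLM.circleAverage_comp_comm hint
  have hconj : Real.circleAverage (fun z => conjCLE (z ^ n * h z)) 0 r = 0 := by
    have := (conjCLE : ℂ →L[ℝ] ℂ).circleAverage_comp_comm hint2
    rw [hdc (fun z => z ^ n * h z) ((differentiableOn_id.pow n).mul hh)] at this
    simpa [hn, Function.comp_def] using this
  have hint3 : CircleIntegrable (fun z => ((r : ℂ) ^ (2 * n))⁻¹ • conjCLE (z ^ n * h z)) 0 r := by
    have hc := conjCLE.continuous.comp_continuousOn ((continuousOn_id.pow n).mul hch)
    exact (hc.const_smul ((r : ℂ) ^ (2 * n))⁻¹).circleIntegrable hr.le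
  have hkey : Real.circleAverage (fun z => (z ^ n)⁻¹ * h z) 0 r =
      Real.circleAverage (fun z => (z ^ n)⁻¹ * ((2 * (h z).re : ℝ) : ℂ)) 0 r := by
    have hzero : Real.circleAverage
        (fun z => ((r : ℂ) ^ (2 * n))⁻¹ • conjCLE (z ^ n * h z)) 0 r = 0 := by
      rw [Real.circleAverage_fun_smul, hconj, smul_zero]
    rw [← add_zero (Real.circleAverage (fun z => (z ^ n)⁻¹ * h z) 0 r)]
    nth_rw 2 [← hzero]
    rw [← Real.circleAverage_fun_add hint1 hint3]
    refine Real.circleAverage_congr_sphere fun z hz => ?_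
    rw [abs_of_pos hr] at hz
    have hz0 := hne z hz
    have hzz : z * (starRingEnd ℂ) z = (r : ℂ) ^ 2 := by
      rw [mul_conj', mem_sphere_zero_iff_norm.mp hz]
    have hcz : (starRingEnd ℂ) z ≠ 0 := by simpa using hz0
    simp only [conjCLE_apply, map_mul, map_pow, smul_eq_mul]
    rw [pow_mul, ← hzz, mul_pow, ← add_conj]
    field_simp
  have hbound : ‖Real.circleAverage (fun z => (z ^ n)⁻¹ * ((2 * (h z).re : ℝ) : ℂ)) 0 r‖ ≤
      Real.circleAverage (fun z => (r ^ n)⁻¹ * 2 * (h z).re) 0 r := by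
    rw [Real.circleAverage_def, Real.circleAverage_def, norm_smul, Real.norm_of_nonneg
      (by positivity), smul_eq_mul]
    refine mul_le_mul_of_nonneg_left ?_ (by positivity)
    refine (intervalIntegral.norm_integral_le_integral_norm Real.two_pi_pos.le).trans_eq ?_
    refine intervalIntegral.integral_congr fun θ _ => ?_
    have h0 := hre _ (circleMap_mem_closedBall 0 hr.le θ)
    simp only [norm_mul, norm_inv, norm_pow, norm_circleMap_zero, abs_of_pos hr, norm_real,
      Real.norm_eq_abs, abs_of_nonneg h0, abs_two]
    ring
  have hval : Real.circleAverage (fun z => (r ^ n)⁻¹ * 2 * (h z).re) 0 r =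
      (r ^ n)⁻¹ * 2 * (h 0).re := by
    rw [← hre_avg]
    exact Real.circleAverage_fun_smul (a := (r ^ n)⁻¹ * 2)
  rw [hkey]
  rw [hval] at hbound
  calc _ ≤ (r ^ n)⁻¹ * 2 * (h 0).re * r ^ n := by gcongr
    _ = 2 * (h 0).re := by
      field_simp

/-- The **Carathéodory coefficient inequality** for `A + z * deriv G z`, in terms of the coefficients
of `G`. -/
theorem natCast_mul_norm_le_of_re_id_mul_deriv {G : ℂ → ℂ} {c : ℕ → ℂ} {A : ℝ}
    (hG : ∀ z ∈ ball (0 : ℂ) 1, HasSum (fun n : ℕ => c n * z ^ n) (G z))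
    (hre : ∀ z ∈ ball (0 : ℂ) 1, -A ≤ (z * deriv G z).re) {n : ℕ} (hn : n ≠ 0) :
    n * ‖c n‖ ≤ 2 * A := by
  have hP := hasFPowerSeriesOnBall_ofScalars_of_hasSum hG
  have han : ∀ z ∈ ball (0 : ℂ) 1, AnalyticAt ℂ G z := fun z hz =>
    hP.analyticAt_of_mem (by rwa [← ENNReal.ofReal_one, eball_ofReal])
  have hbound : ∀ r ∈ Set.Ioo (0 : ℝ) 1, n * ‖c n‖ * r ^ n ≤ 2 * A := by
    rintro r ⟨hr, hr1⟩
    have hsub : closedBall (0 : ℂ) r ⊆ ball 0 1 := closedBall_subset_ball hr1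
    have hD : DifferentiableOn ℂ (fun z => z * deriv G z) (closedBall 0 r) := fun z hz =>
      (differentiableAt_id.mul (han z (hsub hz)).deriv.differentiableAt).differentiableWithinAt
    have h1 := norm_circleAverage_inv_pow_mul_le hr (h := fun z => A + z * deriv G z)
      (hD.const_add _)
      (fun z hz => by
        have := hre z (hsub hz)
        simp only [add_re, ofReal_re]
        linarith) hn
    have h2 := circleAverage_inv_pow_mul_id_mul_deriv hr (fun z hz => han z (hsub hz)) n
    rw [circleAverage_inv_pow_mul_of_hasFPowerSeriesAt hr
      (fun z hz => (han z (hsub hz)).differentiableAt.differentiableWithinAt)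
      hP.hasFPowerSeriesAt, FormalMultilinearSeries.coeff_ofScalars] at h2
    have h3 : Real.circleAverage (fun z => (z ^ n)⁻¹ * (A + z * deriv G z)) 0 r = n * c n := by
      have hconst := circleAverage_inv_pow_mul_of_hasFPowerSeriesAt hr
        (differentiableOn_const (A : ℂ)) hasFPowerSeriesAt_const n
      obtain ⟨m, rfl⟩ := Nat.exists_eq_succ_of_ne_zero hn
      have hpow : ContinuousOn (fun z : ℂ => (z ^ (m + 1))⁻¹) (sphere 0 r) :=
        (continuousOn_id.pow _).inv₀ fun z hz => pow_ne_zero _ (ne_of_mem_sphere hz hr.ne')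
      have hi1 : CircleIntegrable (fun z => (z ^ (m + 1))⁻¹ * (A : ℂ)) 0 r :=
        (hpow.mul continuousOn_const).circleIntegrable hr.le
      have hi2 : CircleIntegrable (fun z => (z ^ (m + 1))⁻¹ * (z * deriv G z)) 0 r :=
        (hpow.mul (hD.continuousOn.mono sphere_subset_closedBall)).circleIntegrable hr.le
      simp_rw [mul_add]
      rw [Real.circleAverage_fun_add hi1 hi2, hconst, h2]
      simp [FormalMultilinearSeries.coeff]
    rw [h3] at h1
    simpa using h1
  have hlim : Filter.Tendsto (fun r : ℝ => n * ‖c n‖ * r ^ n) (nhdsWithin 1 (Set.Iio 1))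
      (nhds (n * ‖c n‖ * 1 ^ n)) :=
    ((continuous_const.mul (continuous_pow n)).tendsto 1).mono_left nhdsWithin_le_nhds
  have := le_of_tendsto hlim (Filter.mem_of_superset (Ioo_mem_nhdsLT one_pos) hbound)
  simpa using this

/-- `((β-α)/(nπ))|sin(π(1-α)/(β-α))| ≤ (1-α)/n` for `0 ≤ α < 1 < β`; consequently the
logarithmic coefficients of a starlike function of order `α` satisfy `|γ_n| ≤ (1-α)/n`. -/
theorem logCoeff_bound_starlike_order (α : ℝ) (hα0 : 0 ≤ α) (hα : α < 1) :
    (∀ β : ℝ, 1 < β → ∀ n : ℕ, 1 ≤ n →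
      ((β - α) / (n * Real.pi)) * |Real.sin (Real.pi * (1 - α) / (β - α))| ≤ (1 - α) / n) ∧
    (∀ f : ℂ → ℂ, DifferentiableOn ℂ f (ball 0 1) → f 0 = 0 → deriv f 0 = 1 →
      (∀ z ∈ ball (0 : ℂ) 1, z ≠ 0 → f z ≠ 0) →
      (∀ z ∈ ball (0 : ℂ) 1, z ≠ 0 → α < (z * deriv f z / f z).re) →
      ∀ γ : ℕ → ℂ,
        (∀ z ∈ ball (0 : ℂ) 1, z ≠ 0 →
          HasSum (fun n : ℕ => 2 * γ (n + 1) * z ^ (n + 1)) (Complex.log (f z / z))) →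
        ∀ n : ℕ, 1 ≤ n → ‖γ n‖ ≤ (1 - α) / n) := by
  refine ⟨fun β hβ n hn => ?_, fun f _ _ _ hf0 hre γ hγ n hn => ?_⟩
  · have hn' : (0 : ℝ) < n := by exact_mod_cast hn
    have hβα : 0 < β - α := by linarith
    have hx : 0 ≤ Real.pi * (1 - α) / (β - α) :=
      div_nonneg (mul_nonneg Real.pi_pos.le (by linarith)) hβα.le
    calc (β - α) / (n * Real.pi) * |Real.sin (Real.pi * (1 - α) / (β - α))|
        ≤ (β - α) / (n * Real.pi) * (Real.pi * (1 - α) / (β - α)) := by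
          refine mul_le_mul_of_nonneg_left ?_ (by positivity)
          exact Real.abs_sin_le_abs.trans_eq (abs_of_nonneg hx)
      _ = (1 - α) / n := by
          have := Real.pi_pos
          field_simp
  · have hn' : (0 : ℝ) < n := by exact_mod_cast hn
    set c : ℕ → ℂ := fun n => if n = 0 then 0 else 2 * γ n with hc
    set G : ℂ → ℂ := fun z => if z = 0 then 0 else Complex.log (f z / z) with hGdef
    have hG : ∀ z ∈ ball (0 : ℂ) 1, HasSum (fun n : ℕ => c n * z ^ n) (G z) := by
      intro z hz
      rw [← hasSum_nat_add_iff' 1]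
      by_cases hz0 : z = 0
      · simp [hGdef, hc, hz0]
      · simpa [hGdef, hc, hz0] using hγ z hz hz0
    have hP := hasFPowerSeriesOnBall_ofScalars_of_hasSum hG
    have hreG : ∀ z ∈ ball (0 : ℂ) 1, -(1 - α) ≤ (z * deriv G z).re := by
      intro z hz
      by_cases hz0 : z = 0
      · simp [hz0, hα.le]
      have hd : HasDerivAt G (deriv G z) z :=
        (hP.analyticAt_of_mem
          (by rwa [← ENNReal.ofReal_one, eball_ofReal])).differentiableAt.hasDerivAt
      have hexp : ∀ w ∈ ball (0 : ℂ) 1, w ≠ 0 → w * exp (G w) = f w := fun w hw hw0 => by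
        simp only [hGdef, if_neg hw0]
        rw [exp_log (div_ne_zero (hf0 w hw hw0) hw0), mul_div_cancel₀ _ hw0]
      have heq : f =ᶠ[nhds z] fun w => w * exp (G w) := by
        filter_upwards [isOpen_ball.mem_nhds hz, isOpen_ne.mem_nhds hz0] with w hw hw0
        exact (hexp w hw hw0).symm
      have hf' : deriv f z = 1 * exp (G z) + z * (exp (G z) * deriv G z) := by
        rw [heq.deriv_eq]
        exact ((hasDerivAt_id z).mul hd.cexp).deriv
      have hp : z * deriv f z / f z = 1 + z * deriv G z := by
        rw [hf', ← hexp z hz hz0]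
        have := exp_ne_zero (G z)
        field_simp
      have := hre z hz hz0
      rw [hp, add_re, one_re] at this
      linarith
    have hfin := natCast_mul_norm_le_of_re_id_mul_deriv hG hreG (n := n) (by omega)
    rw [hc] at hfin
    simp only [show n ≠ 0 by omega, if_false, norm_mul, Complex.norm_two] at hfin
    rw [le_div_iff₀ hn']
    linarith
end
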